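/- arXiv:0908.4400 — 4 statements merged into one kernel-verified Lean document; each statement's English description precedes it below -/
import Mathlib

section
/- Let f₀ be a probability density on ℝ^d with ∫_{ℝ^d} ‖x‖ f₀(x) dx < ∞, ∫_{ℝ^d} f₀ log₊ f₀ dμ < ∞, and such that the support E of f₀ has nonempty interior. If f₁* and f₂* are both log-concave densities minimising d_KL(f₀, ·) over the class of all log-concave densities on ℝ^d, then f₁* = f₂* Lebesgue-almost everywhere. -/
open MeasureTheory Filter Classical

/-- A log-concave probability density on ℝ^d (with respect to Lebesgue measure). -/
def IsLogConcaveDensity {d : ℕ} (f : EuclideanSpace ℝ (Fin d) → ℝ) : Prop :=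
  Measurable f ∧ (∀ x, 0 ≤ f x) ∧ (∫ x, f x = 1) ∧
    ∀ x y : EuclideanSpace ℝ (Fin d), ∀ s t : ℝ, 0 ≤ s → 0 ≤ t → s + t = 1 →
      f x ^ s * f y ^ t ≤ f (s • x + t • y)

/-- A probability density on ℝ^d (with respect to Lebesgue measure). -/
def IsDensity {d : ℕ} (f : EuclideanSpace ℝ (Fin d) → ℝ) : Prop :=
  Measurable f ∧ (∀ x, 0 ≤ f x) ∧ (∫ x, f x = 1)

/-- The Kullback–Leibler divergence `∫ f₀ log (f₀ / f) ∈ [0,∞]` of the density `f`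
from the density `f₀`: it is `⊤` unless `f₀` vanishes a.e. where `f` does and the
integrand is integrable (its negative part is always integrable for densities, so
non-integrability can only come from the positive part). -/
noncomputable def klDiv {d : ℕ} (f₀ f : EuclideanSpace ℝ (Fin d) → ℝ) : ENNReal :=
  if Integrable (fun x => f₀ x * Real.log (f₀ x / f x)) ∧ (∀ᵐ x, f x = 0 → f₀ x = 0)
  then ENNReal.ofReal (∫ x, f₀ x * Real.log (f₀ x / f x))
  else ⊤

theorem Real.sub_le_mul_log_div {p q : ℝ} (hp : 0 ≤ p) (hq : 0 ≤ q) (h : q = 0 → p = 0) :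
    p - q ≤ p * Real.log (p / q) := by
  rcases hp.eq_or_lt with rfl | hp
  · simpa using hq
  have hq : 0 < q := hq.lt_of_ne fun h0 => hp.ne' (h h0.symm)
  have h1 := Real.log_le_sub_one_of_pos (div_pos hq hp)
  rw [← inv_div, Real.log_inv] at h1
  have h2 := mul_le_mul_of_nonneg_left h1 hp.le
  have h3 : p * ((p / q)⁻¹ - 1) = q - p := by field_simp
  linarith

theorem integrable_exp_neg_norm_euclidean (d : ℕ) :
    Integrable (fun x : EuclideanSpace ℝ (Fin d) => Real.exp (-‖x‖)) := by
  have h := integrable_one_add_norm (E := EuclideanSpace ℝ (Fin d)) (μ := volume)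
    (r := ((d + 1 : ℕ) : ℝ)) (by simp)
  refine (h.const_mul (((d + 1).factorial : ℝ) * Real.exp 1)).mono' (by fun_prop) (.of_forall ?_)
  intro x
  have hx : 0 < 1 + ‖x‖ := by positivity
  have h1 := Real.pow_div_factorial_le_exp (1 + ‖x‖) hx.le (d + 1)
  have hfac : (0 : ℝ) < (d + 1).factorial := by positivity
  rw [div_le_iff₀ hfac, Real.exp_add] at h1
  rw [Real.norm_of_nonneg (Real.exp_pos _).le, Real.rpow_neg hx.le, Real.rpow_natCast,
    Real.exp_neg, ← div_eq_mul_inv, le_div_iff₀ (by positivity), inv_mul_le_iff₀ (Real.exp_pos _)]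
  linarith

theorem IsLogConcaveDensity.isDensity {d : ℕ} {f : EuclideanSpace ℝ (Fin d) → ℝ}
    (hf : IsLogConcaveDensity f) : IsDensity f :=
  ⟨hf.1, hf.2.1, hf.2.2.1⟩

theorem IsDensity.integrable {d : ℕ} {f : EuclideanSpace ℝ (Fin d) → ℝ}
    (hf : IsDensity f) : Integrable f :=
  .of_integral_ne_zero (by rw [hf.2.2]; exact one_ne_zero)

/-- Normalising a log-concave function of positive integral yields a log-concave density. -/
theorem IsLogConcaveDensity.of_div_integral {d : ℕ} {h : EuclideanSpace ℝ (Fin d) → ℝ}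
    (hm : Measurable h) (h0 : ∀ x, 0 ≤ h x) (hpos : 0 < ∫ x, h x)
    (hlc : ∀ x y : EuclideanSpace ℝ (Fin d), ∀ s t : ℝ, 0 ≤ s → 0 ≤ t → s + t = 1 →
      h x ^ s * h y ^ t ≤ h (s • x + t • y)) :
    IsLogConcaveDensity (fun x => h x / ∫ y, h y) := by
  refine ⟨hm.div_const _, fun x => div_nonneg (h0 x) hpos.le, ?_, fun x y s t hs ht hst => ?_⟩
  · rw [integral_div, div_self hpos.ne']
  · rw [Real.div_rpow (h0 x) hpos.le, Real.div_rpow (h0 y) hpos.le, div_mul_div_comm,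
      ← Real.rpow_add hpos, hst, Real.rpow_one]
    exact div_le_div_of_nonneg_right (hlc x y s t hs ht hst) hpos.le

/-- Gibbs' inequality. -/
theorem IsDensity.integral_mul_log_div_nonneg {d : ℕ} {f₀ f : EuclideanSpace ℝ (Fin d) → ℝ}
    (hf₀ : IsDensity f₀) (hf : IsDensity f)
    (hint : Integrable (fun x => f₀ x * Real.log (f₀ x / f x)))
    (hac : ∀ᵐ x, f x = 0 → f₀ x = 0) :
    0 ≤ ∫ x, f₀ x * Real.log (f₀ x / f x) := by
  have h := integral_mono_ae (hf₀.integrable.sub hf.integrable) hint (by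
    filter_upwards [hac] with x hx
    exact Real.sub_le_mul_log_div (hf₀.2.1 x) (hf.2.1 x) hx)
  simp only [Pi.sub_apply] at h
  rwa [integral_sub hf₀.integrable hf.integrable, hf₀.2.2, hf.2.2, sub_self] at h

theorem klDiv_ne_top_iff {d : ℕ} {f₀ f : EuclideanSpace ℝ (Fin d) → ℝ} :
    klDiv f₀ f ≠ ⊤ ↔ Integrable (fun x => f₀ x * Real.log (f₀ x / f x)) ∧
      (∀ᵐ x, f x = 0 → f₀ x = 0) := by
  unfold klDiv
  split_ifs with h <;> simp [h]

theorem IsDensity.integrable_mul_log {d : ℕ} {f₀ : EuclideanSpace ℝ (Fin d) → ℝ}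
    (hf₀ : IsDensity f₀) (hmoment : Integrable (fun x => ‖x‖ * f₀ x))
    (hlogplus : Integrable (fun x => f₀ x * max (Real.log (f₀ x)) 0)) :
    Integrable (fun x => f₀ x * Real.log (f₀ x)) := by
  have hm := hf₀.1
  refine ((hlogplus.add hmoment).add (integrable_exp_neg_norm_euclidean d)).mono'
    (by fun_prop) (.of_forall fun x => ?_)
  have h0 := hf₀.2.1 x
  have hu : f₀ x * Real.log (f₀ x) ≤ f₀ x * max (Real.log (f₀ x)) 0 :=
    mul_le_mul_of_nonneg_left (le_max_left _ _) h0
  have hpos : 0 ≤ f₀ x * max (Real.log (f₀ x)) 0 := mul_nonneg h0 (le_max_right _ _)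
  have hmom : 0 ≤ ‖x‖ * f₀ x := by positivity
  have hexp := Real.exp_pos (-‖x‖)
  have hl := Real.sub_le_mul_log_div h0 hexp.le (fun h => absurd h hexp.ne')
  have hsplit : f₀ x * Real.log (f₀ x / Real.exp (-‖x‖))
      = f₀ x * Real.log (f₀ x) + ‖x‖ * f₀ x := by
    rcases h0.eq_or_lt with h | h
    · simp [← h]
    · rw [Real.log_div h.ne' hexp.ne', Real.log_exp]; ring
  rw [hsplit] at hl
  simp only [Pi.add_apply, Real.norm_eq_abs]
  rw [abs_le]
  constructor <;> linarith

/-- Some log-concave density is at finite divergence from `f₀`. -/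
theorem IsDensity.exists_isLogConcaveDensity_klDiv_ne_top {d : ℕ}
    {f₀ : EuclideanSpace ℝ (Fin d) → ℝ} (hf₀ : IsDensity f₀)
    (hmoment : Integrable (fun x => ‖x‖ * f₀ x))
    (hlogplus : Integrable (fun x => f₀ x * max (Real.log (f₀ x)) 0)) :
    ∃ g, IsLogConcaveDensity g ∧ klDiv f₀ g ≠ ⊤ := by
  have hexp := integrable_exp_neg_norm_euclidean d
  have hpos : 0 < ∫ x : EuclideanSpace ℝ (Fin d), Real.exp (-‖x‖) := integral_exp_pos hexp
  set c := ∫ x : EuclideanSpace ℝ (Fin d), Real.exp (-‖x‖) with hc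
  refine ⟨fun x => Real.exp (-‖x‖) / c, .of_div_integral (by fun_prop)
    (fun x => (Real.exp_pos _).le) hpos fun x y s t hs ht hst => ?_, klDiv_ne_top_iff.2 ⟨?_, ?_⟩⟩
  · rw [← Real.exp_mul, ← Real.exp_mul, ← Real.exp_add]
    gcongr
    have := norm_add_le (s • x) (t • y)
    rw [norm_smul_of_nonneg hs, norm_smul_of_nonneg ht] at this
    linarith
  · refine (((hf₀.integrable_mul_log hmoment hlogplus).add hmoment).add
      (hf₀.integrable.mul_const (Real.log c))).congr (.of_forall fun x => ?_)
    simp only [Pi.add_apply]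
    rcases (hf₀.2.1 x).eq_or_lt with h | h
    · simp [← h]
    · rw [Real.log_div h.ne' (by positivity), Real.log_div (Real.exp_pos _).ne' hpos.ne',
        Real.log_exp]
      ring
  · exact .of_forall fun x hx => absurd hx (div_pos (Real.exp_pos _) hpos).ne'

theorem IsDensity.integrable_sqrt_mul {d : ℕ} {f₁ f₂ : EuclideanSpace ℝ (Fin d) → ℝ}
    (hf₁ : IsDensity f₁) (hf₂ : IsDensity f₂) :
    Integrable (fun x => √(f₁ x * f₂ x)) := by
  have hm₁ := hf₁.1
  have hm₂ := hf₂.1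
  refine (hf₁.integrable.add hf₂.integrable).mono' (by fun_prop) (.of_forall fun x => ?_)
  have h₁ := hf₁.2.1 x
  have h₂ := hf₂.2.1 x
  rw [Real.norm_of_nonneg (Real.sqrt_nonneg _), Pi.add_apply, Real.sqrt_le_left (by positivity)]
  nlinarith

/-- Densities whose Bhattacharyya coefficient is at least one agree almost everywhere. -/
theorem IsDensity.ae_eq_of_one_le_integral_sqrt_mul {d : ℕ}
    {f₁ f₂ : EuclideanSpace ℝ (Fin d) → ℝ} (hf₁ : IsDensity f₁) (hf₂ : IsDensity f₂)
    (h : 1 ≤ ∫ x, √(f₁ x * f₂ x)) : ∀ᵐ x, f₁ x = f₂ x := by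
  have hsq : ∀ x, (√(f₁ x) - √(f₂ x)) ^ 2 = f₁ x + f₂ x - 2 * √(f₁ x * f₂ x) := fun x => by
    rw [Real.sqrt_mul (hf₁.2.1 x), sub_sq, Real.sq_sqrt (hf₁.2.1 x), Real.sq_sqrt (hf₂.2.1 x)]
    ring
  have hi := (hf₁.integrable_sqrt_mul hf₂).const_mul 2
  have hs : Integrable fun x => f₁ x + f₂ x := hf₁.integrable.add hf₂.integrable
  have hint : Integrable fun x => (√(f₁ x) - √(f₂ x)) ^ 2 := by
    simp only [hsq]
    exact hs.sub hi
  have hval : ∫ x, (√(f₁ x) - √(f₂ x)) ^ 2 = 2 - 2 * ∫ x, √(f₁ x * f₂ x) := by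
    simp only [hsq]
    rw [integral_sub hs hi, integral_add hf₁.integrable hf₂.integrable, hf₁.2.2, hf₂.2.2,
      integral_const_mul]
    norm_num
  have hzero : ∫ x, (√(f₁ x) - √(f₂ x)) ^ 2 = 0 :=
    le_antisymm (by linarith) (integral_nonneg fun x => sq_nonneg _)
  rw [integral_eq_zero_iff_of_nonneg (fun x => sq_nonneg _) hint] at hzero
  filter_upwards [hzero] with x hx
  exact (Real.sqrt_inj (hf₁.2.1 x) (hf₂.2.1 x)).1
    (sub_eq_zero.1 (pow_eq_zero_iff two_ne_zero |>.1 hx))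

theorem IsDensity.integral_sqrt_mul_pos {d : ℕ} {f₀ f₁ f₂ : EuclideanSpace ℝ (Fin d) → ℝ}
    (hf₀ : IsDensity f₀) (hf₁ : IsDensity f₁) (hf₂ : IsDensity f₂)
    (hac₁ : ∀ᵐ x, f₁ x = 0 → f₀ x = 0) (hac₂ : ∀ᵐ x, f₂ x = 0 → f₀ x = 0) :
    0 < ∫ x, √(f₁ x * f₂ x) := by
  refine (integral_nonneg fun x => Real.sqrt_nonneg _).lt_of_ne fun h => ?_
  have h := (integral_eq_zero_iff_of_nonneg (fun x => Real.sqrt_nonneg _)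
    (hf₁.integrable_sqrt_mul hf₂)).1 h.symm
  have hzero : f₀ =ᵐ[volume] 0 := by
    filter_upwards [h, hac₁, hac₂] with x hx h₁ h₂
    rcases mul_eq_zero.1 ((Real.sqrt_eq_zero
      (mul_nonneg (hf₁.2.1 x) (hf₂.2.1 x))).1 hx) with h0 | h0
    exacts [h₁ h0, h₂ h0]
  have hone := hf₀.2.2
  rw [integral_congr_ae hzero] at hone
  simp at hone

/-- The normalised geometric mean of two log-concave densities is a log-concave density. -/
theorem IsLogConcaveDensity.sqrt_mul {d : ℕ} {f₁ f₂ : EuclideanSpace ℝ (Fin d) → ℝ}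
    (hf₁ : IsLogConcaveDensity f₁) (hf₂ : IsLogConcaveDensity f₂)
    (hpos : 0 < ∫ x, √(f₁ x * f₂ x)) :
    IsLogConcaveDensity (fun x => √(f₁ x * f₂ x) / ∫ y, √(f₁ y * f₂ y)) := by
  obtain ⟨hm₁, h₁, -, hlc₁⟩ := hf₁
  obtain ⟨hm₂, h₂, -, hlc₂⟩ := hf₂
  refine .of_div_integral (by fun_prop) (fun x => Real.sqrt_nonneg _) hpos
    fun x y s t hs ht hst => ?_
  have hrpow : ∀ a b r : ℝ, 0 ≤ a → 0 ≤ b → √(a * b) ^ r = √(a ^ r * b ^ r) :=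
    fun a b r ha hb => by
      rw [Real.sqrt_eq_rpow, Real.sqrt_eq_rpow, ← Real.mul_rpow ha hb,
        ← Real.rpow_mul (mul_nonneg ha hb), ← Real.rpow_mul (mul_nonneg ha hb), mul_comm r]
  rw [hrpow _ _ _ (h₁ x) (h₂ x), hrpow _ _ _ (h₁ y) (h₂ y), ← Real.sqrt_mul
    (mul_nonneg (Real.rpow_nonneg (h₁ x) _) (Real.rpow_nonneg (h₂ x) _)), mul_mul_mul_comm]
  exact Real.sqrt_le_sqrt (mul_le_mul (hlc₁ x y s t hs ht hst) (hlc₂ x y s t hs ht hst)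
    (mul_nonneg (Real.rpow_nonneg (h₂ x) _) (Real.rpow_nonneg (h₂ y) _)) (h₁ _))

/-- Uniqueness (up to Lebesgue-null sets) of the log-concave density minimising the
Kullback–Leibler divergence from `f₀`. -/
theorem klDiv_minimising_logConcave_unique {d : ℕ}
    (f₀ : EuclideanSpace ℝ (Fin d) → ℝ) (hf₀ : IsDensity f₀)
    (hmoment : Integrable (fun x => ‖x‖ * f₀ x))
    (hlogplus : Integrable (fun x => f₀ x * max (Real.log (f₀ x)) 0))
    (E : Set (EuclideanSpace ℝ (Fin d))) (hEclosed : IsClosed E)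
    (hEint : ∫ x in E, f₀ x = 1)
    (hEmin : ∀ F, IsClosed F → (∫ x in F, f₀ x = 1) → E ⊆ F)
    (hEinterior : (interior E).Nonempty)
    (f₁ f₂ : EuclideanSpace ℝ (Fin d) → ℝ)
    (hf₁ : IsLogConcaveDensity f₁) (hf₂ : IsLogConcaveDensity f₂)
    (hmin₁ : ∀ g, IsLogConcaveDensity g → klDiv f₀ f₁ ≤ klDiv f₀ g)
    (hmin₂ : ∀ g, IsLogConcaveDensity g → klDiv f₀ f₂ ≤ klDiv f₀ g) :
    ∀ᵐ x, f₁ x = f₂ x := by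
  obtain ⟨g₀, hg₀, hfin⟩ := hf₀.exists_isLogConcaveDensity_klDiv_ne_top hmoment hlogplus
  have hc₁ := klDiv_ne_top_iff.1 (ne_top_of_le_ne_top hfin (hmin₁ g₀ hg₀))
  have hc₂ := klDiv_ne_top_iff.1 (ne_top_of_le_ne_top hfin (hmin₂ g₀ hg₀))
  have ⟨hi₁, hac₁⟩ := hc₁
  have ⟨hi₂, hac₂⟩ := hc₂
  have hpos := hf₀.integral_sqrt_mul_pos hf₁.isDensity hf₂.isDensity hac₁ hac₂
  refine hf₁.isDensity.ae_eq_of_one_le_integral_sqrt_mul hf₂.isDensity ?_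
  have hg := hf₁.sqrt_mul hf₂ hpos
  set c := ∫ x, √(f₁ x * f₂ x)
  set g := fun x => √(f₁ x * f₂ x) / c with hgdef
  have hpoint : (fun x => 1 / 2 * (f₀ x * Real.log (f₀ x / f₁ x)
      + f₀ x * Real.log (f₀ x / f₂ x)) + f₀ x * Real.log c)
      =ᵐ[volume] fun x => f₀ x * Real.log (f₀ x / g x) := by
    filter_upwards [hac₁, hac₂] with x hx₁ hx₂
    by_cases h0 : f₀ x = 0
    · simp [h0]
    have p₁ : f₁ x ≠ 0 := fun h => h0 (hx₁ h)
    have p₂ : f₂ x ≠ 0 := fun h => h0 (hx₂ h)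
    have hprod : 0 ≤ f₁ x * f₂ x := mul_nonneg (hf₁.2.1 x) (hf₂.2.1 x)
    have hs : √(f₁ x * f₂ x) ≠ 0 := by
      rw [Real.sqrt_ne_zero hprod]
      exact mul_ne_zero p₁ p₂
    rw [Real.log_div h0 p₁, Real.log_div h0 p₂, Real.log_div h0 (div_ne_zero hs hpos.ne'),
      Real.log_div hs hpos.ne', Real.log_sqrt hprod, Real.log_mul p₁ p₂]
    ring
  have hsum := (hi₁.add hi₂).const_mul (1 / 2)
  have hconst := hf₀.integrable.mul_const (Real.log c)
  have hig : Integrable fun x => f₀ x * Real.log (f₀ x / g x) := (hsum.add hconst).congr hpoint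
  have hacg : ∀ᵐ x, g x = 0 → f₀ x = 0 := by
    filter_upwards [hac₁, hac₂] with x hx₁ hx₂ hgx
    have hs := (div_eq_zero_iff.1 hgx).resolve_right hpos.ne'
    rw [Real.sqrt_eq_zero (mul_nonneg (hf₁.2.1 x) (hf₂.2.1 x)), mul_eq_zero] at hs
    exact hs.elim hx₁ hx₂
  have hval := integral_congr_ae hpoint
  rw [integral_add (by exact hsum) hconst, integral_const_mul, integral_add hi₁ hi₂,
    integral_mul_const, hf₀.2.2] at hval
  have hle₁ := hmin₁ g hg
  have hle₂ := hmin₂ g hg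
  have hnn := hf₀.integral_mul_log_div_nonneg hg.isDensity hig hacg
  rw [klDiv, klDiv, if_pos hc₁, if_pos ⟨hig, hacg⟩, ENNReal.ofReal_le_ofReal_iff hnn] at hle₁
  rw [klDiv, klDiv, if_pos hc₂, if_pos ⟨hig, hacg⟩, ENNReal.ofReal_le_ofReal_iff hnn] at hle₂
  exact (Real.log_nonneg_iff hpos).1 (by linarith)
end

section
/- Let f₀ be a probability density on ℝ^d with ∫_{ℝ^d} ‖x‖ f₀(x) dx < ∞, ∫_{ℝ^d} f₀ log₊ f₀ dμ < ∞, and such that the support E of f₀ has nonempty interior. Let f* be a log-concave density minimising d_KL(f₀, ·) over all log-concave densities. If (f_n) is a sequence of log-concave densities on ℝ^d satisfying limsup_{b ↓ 0} limsup_{n → ∞} ∫_{ℝ^d} log((b + f*(x))/(b + f_n(x))) f₀(x) dx ≤ 0, then ∫_{ℝ^d} |f_n(x) − f*(x)| dx → 0 as n → ∞. -/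
open MeasureTheory Filter Classical

open Topology

theorem Convex.subset_of_subset_closure {V : Type*} [NormedAddCommGroup V] [NormedSpace ℝ V]
    [FiniteDimensional ℝ V] {s u : Set V} (hs : Convex ℝ s) (hu : IsOpen u)
    (hus : u ⊆ closure s) : u ⊆ s := by
  intro x hx
  have hx' : x ∈ interior (closure s) := interior_maximal hus hu hx
  have hspan : affineSpan ℝ s = ⊤ := by
    have h1 : affineSpan ℝ (closure s) = ⊤ :=
      hs.closure.interior_nonempty_iff_affineSpan_eq_top.1 ⟨x, hx'⟩
    have h2 : closure s ⊆ affineSpan ℝ s :=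
      closure_minimal (subset_affineSpan ℝ s) (AffineSubspace.closed_of_finiteDimensional _)
    exact top_le_iff.1 (h1 ▸ affineSpan_le.2 h2)
  have hint := hs.interior_nonempty_iff_affineSpan_eq_top.2 hspan
  rw [hs.interior_closure_eq_interior_of_nonempty_interior hint] at hx'
  exact interior_subset hx'

/-- A convex set carrying almost all of the mass of a measure contains a fixed ball, provided the
measure charges every ball centred in an open set. -/
theorem exists_ball_subset_of_measure_compl_lt {V : Type*} [NormedAddCommGroup V]
    [InnerProductSpace ℝ V] [FiniteDimensional ℝ V] [MeasurableSpace V] [BorelSpace V]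
    (ν : Measure V) {u : Set V} (hu : IsOpen u) (hune : u.Nonempty)
    (hpos : ∀ z ∈ u, ∀ ρ > 0, 0 < ν (Metric.ball z ρ)) :
    ∃ x₀ : V, ∃ r > 0, ∃ p : ENNReal, 0 < p ∧
      ∀ C : Set V, Convex ℝ C → ν Cᶜ < p → Metric.ball x₀ r ⊆ C := by
  obtain ⟨x₀, hx₀⟩ := hune
  obtain ⟨R, hR, hball⟩ := Metric.nhds_basis_closedBall.mem_iff.1 (hu.mem_nhds hx₀)
  obtain ⟨t, htu, hcov⟩ := (isCompact_closedBall x₀ R).elim_nhds_subcover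
    (fun z => Metric.ball z (R / 8)) (fun z _ => Metric.ball_mem_nhds z (by positivity))
  obtain ⟨p, hp, hpt⟩ : ∃ p : ENNReal, 0 < p ∧ ∀ z ∈ t, p ≤ ν (Metric.ball z (R / 8)) := by
    refine ⟨t.inf fun z => ν (Metric.ball z (R / 8)), ?_, fun z hz => Finset.inf_le hz⟩
    rw [Finset.lt_inf_iff (by simp)]
    exact fun z hz => hpos z (hball (htu z hz)) _ (by positivity)
  refine ⟨x₀, R / 2, by positivity, p, hp, fun C hC hν => ?_⟩
  have hmeet : ∀ z ∈ t, (Metric.ball z (R / 8) ∩ C).Nonempty := by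
    intro z hz
    by_contra h
    rw [Set.not_nonempty_iff_eq_empty] at h
    have : Metric.ball z (R / 8) ⊆ Cᶜ := fun y hy hyC => by
      have : y ∈ Metric.ball z (R / 8) ∩ C := ⟨hy, hyC⟩
      simp [h] at this
    exact absurd ((hpt z hz).trans (measure_mono this)) (not_le.2 hν)
  refine hC.subset_of_subset_closure Metric.isOpen_ball fun y hy => ?_
  by_contra hyC
  obtain ⟨φ, a, hya, haC⟩ := geometric_hahn_banach_point_closed hC.closure isClosed_closure hyC
  set w := (InnerProductSpace.toDual ℝ V).symm φ
  have hw : ∀ z, φ z = inner ℝ w z := fun z => by simp [w]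
  have key : ∀ z ∈ C, 0 < inner ℝ w (z - y) := by
    intro z hz
    have := haC z (subset_closure hz)
    rw [inner_sub_right, ← hw, ← hw]
    linarith
  have hw0 : w ≠ 0 := by
    rintro h
    obtain ⟨z, hz, -⟩ := Set.mem_iUnion₂.1 (hcov (Metric.mem_closedBall_self hR.le))
    obtain ⟨c, -, hc⟩ := hmeet z hz
    simpa [h] using key c hc
  have hwn : 0 < ‖w‖ := norm_pos_iff.2 hw0
  set q : V := x₀ - (3 / 4 * R / ‖w‖) • w with hq
  have hqmem : q ∈ Metric.closedBall x₀ R := by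
    rw [Metric.mem_closedBall, dist_eq_norm, hq, sub_sub_cancel_left, norm_neg, norm_smul,
      Real.norm_of_nonneg (by positivity), div_mul_cancel₀ _ hwn.ne']
    linarith
  obtain ⟨z, hz, hqz⟩ := Set.mem_iUnion₂.1 (hcov hqmem)
  obtain ⟨c, hcz, hc⟩ := hmeet z hz
  have hcq : ‖c - q‖ < R / 4 := by
    rw [← dist_eq_norm]
    have := dist_triangle_right c q z
    rw [Metric.mem_ball] at hqz hcz
    linarith
  have hxy : ‖x₀ - y‖ < R / 2 := by
    rw [← dist_eq_norm, dist_comm]; exact hy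
  have hsplit : inner ℝ w (c - y) = inner ℝ w (c - q) + inner ℝ w (x₀ - y) - 3 / 4 * R * ‖w‖ := by
    have h1 : c - y = (c - q) + (x₀ - y) - (3 / 4 * R / ‖w‖) • w := by rw [hq]; abel
    rw [h1, inner_sub_right, inner_add_right, inner_smul_right, real_inner_self_eq_norm_sq]
    field_simp
  have h1 := real_inner_le_norm w (c - q)
  have h2 := real_inner_le_norm w (x₀ - y)
  have h3 := key c hc
  nlinarith

/-- Log-concavity of a nonnegative function, in multiplicative form. -/
def IsLogConcave {V : Type*} [AddCommGroup V] [Module ℝ V] (f : V → ℝ) : Prop :=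
  ∀ x y : V, ∀ s t : ℝ, 0 ≤ s → 0 ≤ t → s + t = 1 → f x ^ s * f y ^ t ≤ f (s • x + t • y)

theorem min_le_rpow_mul_rpow {a b s t : ℝ} (ha : 0 ≤ a) (hb : 0 ≤ b) (hs : 0 ≤ s) (ht : 0 ≤ t)
    (hst : s + t = 1) : min a b ≤ a ^ s * b ^ t := by
  have hm : 0 ≤ min a b := le_min ha hb
  calc min a b = min a b ^ s * min a b ^ t := by
        rw [← Real.rpow_add_of_nonneg hm hs ht, hst, Real.rpow_one]
    _ ≤ a ^ s * b ^ t := by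
        gcongr
        · exact min_le_left _ _
        · exact min_le_right _ _

namespace IsLogConcave

variable {V : Type*} [AddCommGroup V] [Module ℝ V] {f g : V → ℝ}

theorem min_le (hf : IsLogConcave f) (h0 : ∀ x, 0 ≤ f x) {x y : V} {s t : ℝ} (hs : 0 ≤ s)
    (ht : 0 ≤ t) (hst : s + t = 1) : min (f x) (f y) ≤ f (s • x + t • y) :=
  (min_le_rpow_mul_rpow (h0 x) (h0 y) hs ht hst).trans (hf x y s t hs ht hst)

theorem convex_lt (hf : IsLogConcave f) (h0 : ∀ x, 0 ≤ f x) (c : ℝ) : Convex ℝ {x | c < f x} :=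
  fun _ hx _ hy _ _ hs ht hst => (lt_min hx hy).trans_le (hf.min_le h0 hs ht hst)

theorem convex_le (hf : IsLogConcave f) (h0 : ∀ x, 0 ≤ f x) (c : ℝ) : Convex ℝ {x | c ≤ f x} :=
  fun _ hx _ hy _ _ hs ht hst => (le_min hx hy).trans (hf.min_le h0 hs ht hst)

theorem sqrt_mul_sqrt_div (hf : IsLogConcave f) (hg : IsLogConcave g) (hf0 : ∀ x, 0 ≤ f x)
    (hg0 : ∀ x, 0 ≤ g x) {Z : ℝ} (hZ : 0 < Z) :
    IsLogConcave fun x => √(f x) * √(g x) / Z := by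
  intro x y s t hs ht hst
  have h1 := Real.sqrt_le_sqrt (hf x y s t hs ht hst)
  have h2 := Real.sqrt_le_sqrt (hg x y s t hs ht hst)
  have hsq : ∀ {a b : ℝ}, 0 ≤ a → 0 ≤ b → √(a ^ s * b ^ t) = √a ^ s * √b ^ t := by
    intro a b ha hb
    rw [Real.sqrt_mul (by positivity), Real.sqrt_eq_rpow, Real.sqrt_eq_rpow, Real.sqrt_eq_rpow,
      Real.sqrt_eq_rpow, ← Real.rpow_mul ha, ← Real.rpow_mul ha, ← Real.rpow_mul hb,
      ← Real.rpow_mul hb, mul_comm s, mul_comm t]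
  rw [hsq (hf0 x) (hf0 y)] at h1
  rw [hsq (hg0 x) (hg0 y)] at h2
  have hZ' : Z ^ s * Z ^ t = Z := by
    rw [← Real.rpow_add hZ, hst, Real.rpow_one]
  calc (√(f x) * √(g x) / Z) ^ s * (√(f y) * √(g y) / Z) ^ t
      = (√(f x) ^ s * √(f y) ^ t) * (√(g x) ^ s * √(g y) ^ t) / (Z ^ s * Z ^ t) := by
        rw [Real.div_rpow (by positivity) hZ.le, Real.div_rpow (by positivity) hZ.le,
          Real.mul_rpow (by positivity) (by positivity),
          Real.mul_rpow (by positivity) (by positivity)]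
        ring
    _ ≤ √(f (s • x + t • y)) * √(g (s • x + t • y)) / Z := by rw [hZ']; gcongr

theorem liminf {fs : ℕ → V → ℝ} (hfs : ∀ n, IsLogConcave (fs n)) (h0 : ∀ n x, 0 ≤ fs n x) {M : ℝ}
    (hM : ∀ n x, fs n x ≤ M) : IsLogConcave fun x => liminf (fun n => fs n x) atTop := by
  have hbd : ∀ x, IsBoundedUnder (· ≥ ·) atTop fun n => fs n x :=
    fun x => isBoundedUnder_of ⟨0, fun n => h0 n x⟩
  have hcobd : ∀ x, IsCoboundedUnder (· ≥ ·) atTop fun n => fs n x :=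
    fun x => (isBoundedUnder_of ⟨M, fun n => hM n x⟩ :
      IsBoundedUnder (· ≤ ·) atTop _).isCoboundedUnder_ge
  have hL0 : ∀ x, 0 ≤ Filter.liminf (fun n => fs n x) atTop := fun x =>
    le_liminf_of_le (hcobd x) (Eventually.of_forall fun n => h0 n x)
  intro x y s t hs ht hst
  dsimp only
  rcases hs.eq_or_lt with rfl | hs
  · obtain rfl : t = 1 := by linarith
    simp
  rcases ht.eq_or_lt with rfl | ht
  · obtain rfl : s = 1 := by linarith
    simp
  set A := Filter.liminf (fun n => fs n x) atTop with hA
  set B := Filter.liminf (fun n => fs n y) atTop with hB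
  rcases (hL0 x).eq_or_lt with h | hApos
  · rw [← hA] at h
    rw [← h, Real.zero_rpow hs.ne', zero_mul]; exact hL0 _
  rcases (hL0 y).eq_or_lt with h | hBpos
  · rw [← hB] at h
    rw [← h, Real.zero_rpow ht.ne', mul_zero]; exact hL0 _
  rw [← hA] at hApos
  rw [← hB] at hBpos
  have hθ : ∀ θ : ℝ, 0 < θ → θ < 1 →
      θ * (A ^ s * B ^ t) ≤ Filter.liminf (fun n => fs n (s • x + t • y)) atTop := by
    intro θ hθ0 hθ1
    refine le_liminf_of_le (hcobd _) ?_
    filter_upwards [eventually_lt_of_lt_liminf (show θ * A < _ by rw [← hA]; nlinarith) (hbd x),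
      eventually_lt_of_lt_liminf (show θ * B < _ by rw [← hB]; nlinarith) (hbd y)] with n hx hy
    calc θ * (A ^ s * B ^ t) = (θ * A) ^ s * (θ * B) ^ t := by
          rw [Real.mul_rpow hθ0.le hApos.le, Real.mul_rpow hθ0.le hBpos.le]
          have : θ ^ s * θ ^ t = θ := by rw [← Real.rpow_add hθ0, hst, Real.rpow_one]
          linear_combination -(A ^ s * B ^ t) * this
      _ ≤ fs n x ^ s * fs n y ^ t := by
          have := h0 n x
          gcongr
      _ ≤ _ := hfs n x y s t hs.le ht.le hst
  have hlim : Tendsto (fun θ : ℝ => θ * (A ^ s * B ^ t)) (𝓝[<] 1) (𝓝 (1 * (A ^ s * B ^ t))) :=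
    (tendsto_id.mul_const _).mono_left nhdsWithin_le_nhds
  rw [one_mul] at hlim
  refine le_of_tendsto hlim ?_
  filter_upwards [Ioo_mem_nhdsLT (show (0 : ℝ) < 1 by norm_num)] with θ hθ'
  exact hθ θ hθ'.1 hθ'.2

end IsLogConcave

/-- A uniformly bounded sequence of log-concave functions that is bounded below by a positive
constant on a fixed ball has an almost everywhere convergent subsequence. -/
theorem exists_subseq_tendsto_liminf_ae {V : Type*} [NormedAddCommGroup V] [NormedSpace ℝ V]
    [FiniteDimensional ℝ V] [MeasurableSpace V] [BorelSpace V] (μ : Measure V)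
    [μ.IsAddHaarMeasure] {fs : ℕ → V → ℝ} (hfs : ∀ n, IsLogConcave (fs n))
    (h0 : ∀ n x, 0 ≤ fs n x) {M : ℝ} (hM : ∀ n x, fs n x ≤ M) {x₀ : V} {r c : ℝ} (hr : 0 < r)
    (hc : 0 < c) (hB : ∀ n, ∀ y ∈ Metric.ball x₀ r, c ≤ fs n y) :
    ∃ φ : ℕ → ℕ, StrictMono φ ∧ ∀ᵐ x ∂μ, Tendsto (fun k => fs (φ k) x) atTop
      (𝓝 (liminf (fun k => fs (φ k) x) atTop)) := by
  obtain ⟨Q, hQc, hQd⟩ := TopologicalSpace.exists_countable_dense V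
  have : Countable Q := hQc.to_subtype
  obtain ⟨l, -, φ, hφ, hlim⟩ := (isCompact_univ_pi fun _ : Q => isCompact_Icc (a := (0 : ℝ))
    (b := M)).isSeqCompact (x := fun n (q : Q) => fs n q)
    (fun n => Set.mem_univ_pi.2 fun q => ⟨h0 n q, hM n q⟩)
  rw [tendsto_pi_nhds] at hlim
  refine ⟨φ, hφ, ?_⟩
  set F : V → ℝ := fun x => liminf (fun k => fs (φ k) x) atTop with hF
  have hFlc : IsLogConcave F := .liminf (fun k => hfs (φ k)) (fun k => h0 (φ k)) fun k => hM (φ k)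
  have hbd : ∀ x, IsBoundedUnder (· ≥ ·) atTop fun k => fs (φ k) x :=
    fun x => isBoundedUnder_of ⟨0, fun n => h0 _ x⟩
  have hF0 : ∀ x, 0 ≤ F x := fun x =>
    le_liminf_of_le (isBoundedUnder_of ⟨M, fun n => hM _ x⟩ :
      IsBoundedUnder (· ≤ ·) atTop _).isCoboundedUnder_ge (Eventually.of_forall fun n => h0 _ x)
  have hFQ : ∀ q ∈ Q, Tendsto (fun k => fs (φ k) q) atTop (𝓝 (F q)) := fun q hq => by
    have h : Tendsto (fun k => fs (φ k) q) atTop (𝓝 (l ⟨q, hq⟩)) := hlim ⟨q, hq⟩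
    have e : F q = l ⟨q, hq⟩ := h.liminf_eq
    rwa [e]
  have hnull : ∀ᵐ x ∂μ, ∀ s : ℚ, x ∉ frontier {x | (s : ℝ) < F x} :=
    ae_all_iff.2 fun s =>
      measure_eq_zero_iff_ae_notMem.1 ((hFlc.convex_lt hF0 s).addHaar_frontier μ)
  filter_upwards [hnull] with x hx
  refine tendsto_order.2 ⟨fun a ha => eventually_lt_of_lt_liminf ha (hbd x), fun a ha => ?_⟩
  by_contra hcon
  rw [not_eventually] at hcon
  simp only [not_lt] at hcon
  obtain ⟨s, hs1, hs2⟩ := exists_rat_btwn ha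
  obtain ⟨s', hs1', hs2'⟩ := exists_between hs2
  have hs0 : (0 : ℝ) < s := (hF0 x).trans_lt hs1
  have ha0 : 0 < a := by linarith
  have hxcl : x ∉ closure {x | (s : ℝ) < F x} := by
    intro h
    rw [closure_eq_self_union_frontier] at h
    rcases h with h | h
    · exact lt_asymm h hs1
    · exact hx s h
  obtain ⟨lam, ⟨⟨hl1, hl2⟩, hl3⟩, hl0⟩ : ∃ lam : ℝ,
      ((s' < a ^ (1 - lam) * c ^ lam ∧
        (1 - lam) • x + lam • x₀ ∈ (closure {x | (s : ℝ) < F x})ᶜ) ∧ lam < 1) ∧ 0 < lam := by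
    have e1 : ∀ᶠ lam : ℝ in 𝓝 0, s' < a ^ (1 - lam) * c ^ lam := by
      have : ContinuousAt (fun lam : ℝ => a ^ (1 - lam) * c ^ lam) 0 := by
        refine ContinuousAt.mul ?_ ?_
        · exact ContinuousAt.rpow (by fun_prop) (by fun_prop) (Or.inl ha0.ne')
        · exact ContinuousAt.rpow (by fun_prop) (by fun_prop) (Or.inl hc.ne')
      exact this.eventually (lt_mem_nhds (by simpa using hs2'))
    have e2 : ∀ᶠ lam : ℝ in 𝓝 0,
        (1 - lam) • x + lam • x₀ ∈ (closure {x | (s : ℝ) < F x})ᶜ := by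
      have : ContinuousAt (fun lam : ℝ => (1 - lam) • x + lam • x₀) 0 := by fun_prop
      exact this.eventually (isClosed_closure.isOpen_compl.mem_nhds (by simpa using hxcl))
    have e3 : ∀ᶠ lam : ℝ in 𝓝 0, lam < 1 := gt_mem_nhds one_pos
    exact ((((e1.and e2).and e3).filter_mono nhdsWithin_le_nhds).and
      (self_mem_nhdsWithin : Set.Ioi (0 : ℝ) ∈ 𝓝[>] 0)).exists
  set z := (1 - lam) • x + lam • x₀ with hz
  obtain ⟨q, ⟨hq1, hq2⟩, hqQ⟩ := hQd.inter_open_nonempty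
    (Metric.ball z (lam * r) ∩ (closure {x | (s : ℝ) < F x})ᶜ)
    (Metric.isOpen_ball.inter isClosed_closure.isOpen_compl)
    ⟨z, Metric.mem_ball_self (by positivity), hl2⟩
  have hy : x₀ + lam⁻¹ • (q - z) ∈ Metric.ball x₀ r := by
    rw [Metric.mem_ball, dist_eq_norm, add_sub_cancel_left, norm_smul, norm_inv,
      Real.norm_of_nonneg hl0.le, inv_mul_lt_iff₀ hl0, ← dist_eq_norm]
    exact hq1
  have hqy : q = (1 - lam) • x + lam • (x₀ + lam⁻¹ • (q - z)) := by
    rw [smul_add, smul_inv_smul₀ hl0.ne', ← add_assoc, ← hz, add_sub_cancel]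
  have hfreq : ∃ᶠ k in atTop, s' ≤ fs (φ k) q := by
    refine hcon.mono fun k hk => hl1.le.trans ?_
    have h1 := hfs (φ k) x (x₀ + lam⁻¹ • (q - z)) (1 - lam) lam (by linarith) hl0.le (by ring)
    rw [← hqy] at h1
    refine le_trans ?_ h1
    have h2 := hB (φ k) _ hy
    have h3 : 0 ≤ 1 - lam := by linarith
    have h4 := h0 (φ k) x
    gcongr
  have hFq : s' ≤ F q := by
    by_contra h
    rw [not_le] at h
    exact hfreq (((hFQ q hqQ).eventually (gt_mem_nhds h)).mono fun k hk => not_le.2 hk)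
  exact hq2 (subset_closure (show (s : ℝ) < F q by linarith))

/-- A log-concave function with integral at most one that is at least `c` on a ball is bounded by
a constant depending only on `c` and the radius of the ball. -/
theorem IsLogConcave.le_of_le_on_ball {V : Type*} [NormedAddCommGroup V] [NormedSpace ℝ V]
    [FiniteDimensional ℝ V] [MeasurableSpace V] [BorelSpace V] (μ : Measure V)
    [μ.IsAddHaarMeasure] {f : V → ℝ} (hf : IsLogConcave f) (h0 : ∀ x, 0 ≤ f x)
    (hint : Integrable f μ) (hone : ∫ x, f x ∂μ ≤ 1) {x₀ : V} {r c : ℝ} (hr : 0 < r)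
    (hc : 0 < c) (hB : ∀ y ∈ Metric.ball x₀ r, c ≤ f y) (x : V) :
    f x ≤ 1 / (c * μ.real (Metric.ball 0 (r / 2)) ^ 2) := by
  set v := μ.real (Metric.ball (0 : V) (r / 2)) with hv
  have hvpos : 0 < v :=
    ENNReal.toReal_pos (Metric.measure_ball_pos μ _ (by positivity)).ne' measure_ball_lt_top.ne
  set m := (1 / 2 : ℝ) • (x + x₀)
  have hvm : μ.real (Metric.ball m (r / 2)) = v := by
    rw [hv, Measure.real, Measure.real, Measure.addHaar_ball_center]
  have hlow : ∀ z ∈ Metric.ball m (r / 2), √(f x * c) ≤ f z := by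
    intro z hz
    have hy : (2 : ℝ) • z - x ∈ Metric.ball x₀ r := by
      have : (2 : ℝ) • z - x - x₀ = (2 : ℝ) • (z - m) := by
        rw [smul_sub, smul_smul]; norm_num; abel
      rw [Metric.mem_ball, dist_eq_norm, this, norm_smul, Real.norm_ofNat, ← dist_eq_norm]
      rw [Metric.mem_ball] at hz
      linarith
    have h1 := hf x ((2 : ℝ) • z - x) (1 / 2) (1 / 2) (by norm_num) (by norm_num) (by norm_num)
    have h2 : (1 / 2 : ℝ) • x + (1 / 2 : ℝ) • ((2 : ℝ) • z - x) = z := by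
      rw [smul_sub, smul_smul]; norm_num
    rw [h2] at h1
    refine le_trans ?_ h1
    rw [← Real.mul_rpow (h0 _) (h0 _), ← Real.sqrt_eq_rpow]
    exact Real.sqrt_le_sqrt (mul_le_mul_of_nonneg_left (hB _ hy) (h0 x))
  have h1 : √(f x * c) * v ≤ 1 := by
    calc √(f x * c) * v = ∫ _ in Metric.ball m (r / 2), √(f x * c) ∂μ := by
          rw [setIntegral_const, hvm, smul_eq_mul, mul_comm]
      _ ≤ ∫ z in Metric.ball m (r / 2), f z ∂μ :=
          setIntegral_mono_on (integrableOn_const measure_ball_lt_top.ne) hint.integrableOn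
            measurableSet_ball hlow
      _ ≤ ∫ z, f z ∂μ := setIntegral_le_integral hint (Eventually.of_forall h0)
      _ ≤ 1 := hone
  have h2 : f x * c * v ^ 2 ≤ 1 := by
    calc f x * c * v ^ 2 = (√(f x * c) * v) ^ 2 := by
          rw [mul_pow, Real.sq_sqrt (mul_nonneg (h0 x) hc.le)]
      _ ≤ 1 := pow_le_one₀ (by positivity) h1
  rw [le_div_iff₀ (by positivity)]
  linarith

theorem mul_log_add_sub_le_mul_log {a y : ℝ} (ha : 0 ≤ a) (hy : 0 < y) :
    a * Real.log y + a - y ≤ a * Real.log a := by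
  rcases ha.eq_or_lt with rfl | ha
  · simpa using hy.le
  have h1 := Real.log_le_sub_one_of_pos (div_pos hy ha)
  rw [Real.log_div hy.ne' ha.ne'] at h1
  have h2 := mul_le_mul_of_nonneg_left h1 ha.le
  have h3 : a * (y / a - 1) = y - a := by field_simp
  linarith

theorem mul_log_add_le {a b y : ℝ} (ha : 0 ≤ a) (hb : 0 < b) (hy : 0 ≤ y) :
    a * Real.log (b + y) ≤ a * Real.log (1 + b) + a * max (Real.log a) 0 + y := by
  have hmax : 0 ≤ a * max (Real.log a) 0 := mul_nonneg ha (le_max_right _ _)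
  rcases le_total y 1 with h | h
  · have : Real.log (b + y) ≤ Real.log (1 + b) := Real.log_le_log (by linarith) (by linarith)
    have := mul_le_mul_of_nonneg_left this ha
    linarith
  · have h1 : Real.log (b + y) ≤ Real.log (1 + b) + Real.log y := by
      rw [← Real.log_mul (by linarith) (by linarith)]
      exact Real.log_le_log (by linarith) (by nlinarith)
    have h2 := mul_le_mul_of_nonneg_left h1 ha
    have h3 := mul_log_add_sub_le_mul_log ha (show 0 < y by linarith)
    have h4 := mul_le_mul_of_nonneg_left (le_max_left (Real.log a) 0) ha
    linarith

section Entropy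

variable {α : Type*} [MeasurableSpace α] {μ : Measure α} {f₀ f : α → ℝ}

theorem integrable_mul_log_const_add (hf₀ : Integrable f₀ μ) (hf₀0 : ∀ x, 0 ≤ f₀ x)
    (hlog : Integrable (fun x => f₀ x * max (Real.log (f₀ x)) 0) μ) (hf : Integrable f μ)
    (hf0 : ∀ x, 0 ≤ f x) {b : ℝ} (hb : 0 < b) :
    Integrable (fun x => f₀ x * Real.log (b + f x)) μ := by
  refine integrable_of_le_of_le (hf₀.aestronglyMeasurable.mul ?_)
    (Eventually.of_forall fun x => ?_)
    (Eventually.of_forall fun x => mul_log_add_le (hf₀0 x) hb (hf0 x))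
    (hf₀.mul_const (Real.log b)) (((hf₀.mul_const (Real.log (1 + b))).add hlog).add hf)
  · exact (Real.measurable_log.comp_aemeasurable
      (hf.aemeasurable.const_add b)).aestronglyMeasurable
  · exact mul_le_mul_of_nonneg_left (Real.log_le_log hb (by linarith [hf0 x])) (hf₀0 x)

theorem exists_setIntegral_lt_of_le_integral_log (hf₀ : Integrable f₀ μ) (hf₀0 : ∀ x, 0 ≤ f₀ x)
    (hf₀1 : ∫ x, f₀ x ∂μ = 1) (hlog : Integrable (fun x => f₀ x * max (Real.log (f₀ x)) 0) μ)
    (L : ℝ) {p : ℝ} (hp : 0 < p) :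
    ∃ b₀ > 0, ∀ b, 0 < b → b < b₀ → ∀ f : α → ℝ, Measurable f → Integrable f μ →
      (∀ x, 0 ≤ f x) → ∫ x, f x ∂μ ≤ 1 → L ≤ ∫ x, f₀ x * Real.log (b + f x) ∂μ →
      ∫ x in {x | f x < b}, f₀ x ∂μ < p := by
  set K := ∫ x, f₀ x * max (Real.log (f₀ x)) 0 ∂μ
  set C := K + Real.log 2 + 1 - L
  refine ⟨min (1 / 2) (Real.exp (-(C / p)) / 2), by positivity,
    fun b hb hbb f hfm hf hf0 hf1 hL => ?_⟩
  rw [lt_min_iff] at hbb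
  set A := {x | f x < b}
  have hA : MeasurableSet A := hfm measurableSet_Iio
  set m := ∫ x in A, f₀ x ∂μ
  have hle : ∫ x, f₀ x * Real.log (b + f x) ∂μ ≤ m * Real.log (2 * b) + (Real.log 2 + K + 1) := by
    have hi1 : Integrable (fun x => A.indicator f₀ x * Real.log (2 * b)) μ :=
      (hf₀.indicator hA).mul_const _
    have hi2 : Integrable (fun x => f₀ x * Real.log 2 + f₀ x * max (Real.log (f₀ x)) 0) μ :=
      (hf₀.mul_const (Real.log 2)).add hlog
    have hi3 : Integrable
        (fun x => f₀ x * Real.log 2 + f₀ x * max (Real.log (f₀ x)) 0 + f x) μ := hi2.add hf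
    calc ∫ x, f₀ x * Real.log (b + f x) ∂μ
        ≤ ∫ x, A.indicator f₀ x * Real.log (2 * b) +
            ((f₀ x * Real.log 2 + f₀ x * max (Real.log (f₀ x)) 0) + f x) ∂μ := by
          refine integral_mono (integrable_mul_log_const_add hf₀ hf₀0 hlog hf hf0 hb)
            (hi1.add hi3) fun x => ?_
          have h2 : 0 ≤ f₀ x * Real.log 2 := mul_nonneg (hf₀0 x) (Real.log_nonneg (by norm_num))
          have h3 : 0 ≤ f₀ x * max (Real.log (f₀ x)) 0 := mul_nonneg (hf₀0 x) (le_max_right _ _)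
          have h4 := hf0 x
          dsimp only
          by_cases hx : x ∈ A
          · rw [Set.indicator_of_mem hx]
            have hx' : f x < b := hx
            have := mul_le_mul_of_nonneg_left
              (Real.log_le_log (show 0 < b + f x by linarith) (show b + f x ≤ 2 * b by linarith))
              (hf₀0 x)
            linarith
          · rw [Set.indicator_of_notMem hx]
            have h5 := mul_log_add_le (hf₀0 x) hb (hf0 x)
            have h6 := mul_le_mul_of_nonneg_left
              (Real.log_le_log (show 0 < 1 + b by linarith) (show 1 + b ≤ 2 by linarith))
              (hf₀0 x)
            linarith
      _ = m * Real.log (2 * b) + (Real.log 2 + K + ∫ x, f x ∂μ) := by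
          rw [integral_add hi1 hi3, integral_add hi2 hf,
            integral_add (hf₀.mul_const _) hlog, integral_mul_const, integral_mul_const,
            integral_indicator hA, hf₀1, one_mul]
      _ ≤ _ := by linarith
  by_contra hcon
  rw [not_lt] at hcon
  have h1 : Real.log (2 * b) < -(C / p) := by
    rw [Real.log_lt_iff_lt_exp (by positivity)]
    linarith
  have h2 : Real.log (2 * b) < 0 := Real.log_neg (by positivity) (by linarith)
  have h3 : m * Real.log (2 * b) ≤ p * Real.log (2 * b) :=
    mul_le_mul_of_nonpos_right hcon h2.le
  have h4 : p * Real.log (2 * b) < -C := by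
    calc p * Real.log (2 * b) < p * -(C / p) := by gcongr
      _ = -C := by field_simp
  simp only [C] at h4
  linarith

theorem le_integral_log_of_frequently (hf₀m : Measurable f₀) (hfm : Measurable f)
    (hf₀ : Integrable f₀ μ) (hf₀0 : ∀ x, 0 ≤ f₀ x)
    (hlog : Integrable (fun x => f₀ x * max (Real.log (f₀ x)) 0) μ) (hf : Integrable f μ)
    (hf0 : ∀ x, 0 ≤ f x) {L : ℝ}
    (hL : ∀ ε > 0, ∃ᶠ b in 𝓝[>] (0 : ℝ), L - ε ≤ ∫ x, f₀ x * Real.log (b + f x) ∂μ) :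
    (∀ᵐ x ∂μ, f x = 0 → f₀ x = 0) ∧ Integrable (fun x => f₀ x * Real.log (f x)) μ ∧
      L ≤ ∫ x, f₀ x * Real.log (f x) ∂μ := by
  have hex : ∀ j : ℕ, ∃ b : ℝ, (0 < b ∧ b < 1 / ((j : ℝ) + 1)) ∧
      L - 1 / ((j : ℝ) + 1) ≤ ∫ x, f₀ x * Real.log (b + f x) ∂μ := fun j =>
    (((hL (1 / ((j : ℝ) + 1)) (by positivity)).and_eventually
      (Ioo_mem_nhdsGT (show (0 : ℝ) < 1 / ((j : ℝ) + 1) by positivity))).exists).imp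
        fun b hb => hb.symm
  choose b hb hbL using hex
  have hb1 : ∀ j, b j < 1 := fun j => (hb j).2.trans_le (by
    rw [div_le_one (by positivity)]; linarith [(Nat.cast_nonneg j : (0 : ℝ) ≤ j)])
  have hb0 : Tendsto b atTop (𝓝 0) :=
    squeeze_zero (fun j => (hb j).1.le) (fun j => (hb j).2.le)
      tendsto_one_div_add_atTop_nhds_zero_nat
  set W : α → ℝ := fun x => f₀ x * Real.log 2 + f₀ x * max (Real.log (f₀ x)) 0 + f x with hW
  have hWi : Integrable W μ := ((hf₀.mul_const (Real.log 2)).add hlog).add hf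
  set T := ∫ x, W x ∂μ
  set u : ℕ → α → ℝ := fun j x => W x - f₀ x * Real.log (b j + f x) with hu
  have hui : ∀ j, Integrable (u j) μ := fun j =>
    hWi.sub (integrable_mul_log_const_add hf₀ hf₀0 hlog hf hf0 (hb j).1)
  have hu0 : ∀ j x, 0 ≤ u j x := by
    intro j x
    have h5 := mul_log_add_le (hf₀0 x) (hb j).1 (hf0 x)
    have h6 := mul_le_mul_of_nonneg_left (Real.log_le_log (show 0 < 1 + b j by linarith [(hb j).1])
      (show 1 + b j ≤ 2 by linarith [hb1 j])) (hf₀0 x)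
    simp only [hu, hW]
    linarith
  have hT : ∀ j : ℕ, ∫ x, u j x ∂μ ≤ T - L + 1 / ((j : ℝ) + 1) := by
    intro j
    rw [integral_sub hWi (integrable_mul_log_const_add hf₀ hf₀0 hlog hf hf0 (hb j).1)]
    linarith [hbL j]
  have hTlim : Tendsto (fun j : ℕ => T - L + 1 / ((j : ℝ) + 1)) atTop (𝓝 (T - L)) := by
    simpa using tendsto_one_div_add_atTop_nhds_zero_nat.const_add (T - L)
  have hTL : 0 ≤ T - L :=
    ge_of_tendsto' hTlim fun j => (integral_nonneg (hu0 j)).trans (hT j)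
  have hfatou : ∫⁻ x, liminf (fun j => ENNReal.ofReal (u j x)) atTop ∂μ ≤
      ENNReal.ofReal (T - L) := by
    calc ∫⁻ x, liminf (fun j => ENNReal.ofReal (u j x)) atTop ∂μ
        ≤ liminf (fun j => ∫⁻ x, ENNReal.ofReal (u j x) ∂μ) atTop :=
          lintegral_liminf_le' fun j => (hui j).aemeasurable.ennreal_ofReal
      _ ≤ liminf (fun j : ℕ => ENNReal.ofReal (T - L + 1 / ((j : ℝ) + 1))) atTop := by
          refine liminf_le_liminf (Eventually.of_forall fun j => ?_)
          rw [← ofReal_integral_eq_lintegral_ofReal (hui j) (Eventually.of_forall (hu0 j))]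
          exact ENNReal.ofReal_le_ofReal (hT j)
      _ = ENNReal.ofReal (T - L) := (ENNReal.tendsto_ofReal hTlim).liminf_eq
  have hfin : ∀ᵐ x ∂μ, liminf (fun j => ENNReal.ofReal (u j x)) atTop < ⊤ :=
    ae_lt_top (.liminf fun j => Measurable.ennreal_ofReal (by fun_prop))
      (hfatou.trans_lt ENNReal.ofReal_lt_top).ne
  have hzero : ∀ᵐ x ∂μ, f x = 0 → f₀ x = 0 := by
    filter_upwards [hfin] with x hx hfx
    by_contra hne
    have hpos : 0 < f₀ x := lt_of_le_of_ne (hf₀0 x) (Ne.symm hne)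
    have hlogb : Tendsto (fun j => Real.log (b j)) atTop atBot :=
      Real.tendsto_log_nhdsGT_zero.comp
        (tendsto_nhdsWithin_iff.2 ⟨hb0, Eventually.of_forall fun j => (hb j).1⟩)
    have : Tendsto (fun j => u j x) atTop atTop := by
      simp only [hu, hfx, add_zero, sub_eq_add_neg]
      exact tendsto_atTop_add_const_left _ _
        (tendsto_neg_atBot_atTop.comp (hlogb.const_mul_atBot hpos))
    exact hx.ne (ENNReal.tendsto_ofReal_atTop.comp this).liminf_eq
  have hlim : ∀ᵐ x ∂μ, liminf (fun j => ENNReal.ofReal (u j x)) atTop =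
      ENNReal.ofReal (W x - f₀ x * Real.log (f x)) := by
    filter_upwards [hzero] with x hx
    refine (ENNReal.tendsto_ofReal ?_).liminf_eq
    refine tendsto_const_nhds.sub ?_
    rcases eq_or_ne (f x) 0 with h | h
    · simp [hx h]
    · refine Tendsto.const_mul _ ((Real.continuousAt_log h).tendsto.comp ?_)
      simpa using hb0.add_const (f x)
  have hU0 : ∀ᵐ x ∂μ, 0 ≤ W x - f₀ x * Real.log (f x) := by
    filter_upwards [hzero] with x hx
    rcases eq_or_ne (f x) 0 with h | h
    · simp [hW, hx h, hf0 x]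
    · refine ge_of_tendsto' (f := fun j => u j x) (x := atTop) (tendsto_const_nhds.sub
        (Tendsto.const_mul _ ((Real.continuousAt_log h).tendsto.comp ?_))) fun j => hu0 j x
      simpa using hb0.add_const (f x)
  have hUm : AEStronglyMeasurable (fun x => W x - f₀ x * Real.log (f x)) μ :=
    hWi.aestronglyMeasurable.sub (hf₀.aestronglyMeasurable.mul
      (Real.measurable_log.comp_aemeasurable hf.aemeasurable).aestronglyMeasurable)
  rw [lintegral_congr_ae hlim] at hfatou
  have hUi : Integrable (fun x => W x - f₀ x * Real.log (f x)) μ :=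
    ⟨hUm, (hasFiniteIntegral_iff_ofReal hU0).2 (hfatou.trans_lt ENNReal.ofReal_lt_top)⟩
  have hUT : ∫ x, (W x - f₀ x * Real.log (f x)) ∂μ ≤ T - L := by
    rw [← ofReal_integral_eq_lintegral_ofReal hUi hU0] at hfatou
    exact (ENNReal.ofReal_le_ofReal_iff hTL).1 hfatou
  have hi : Integrable (fun x => f₀ x * Real.log (f x)) μ := by
    refine (hWi.sub hUi).congr (Eventually.of_forall fun x => ?_)
    simp
  refine ⟨hzero, hi, ?_⟩
  rw [integral_sub hWi hi] at hUT
  linarith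

end Entropy

/-- Scheffé's lemma for probability densities. -/
theorem tendsto_lintegral_abs_sub_of_tendsto_ae {α : Type*} [MeasurableSpace α] {μ : Measure α}
    {g : ℕ → α → ℝ} {f : α → ℝ} (hg0 : ∀ n x, 0 ≤ g n x) (hf0 : ∀ x, 0 ≤ f x)
    (hg1 : ∀ n, ∫ x, g n x ∂μ = 1) (hf1 : ∫ x, f x ∂μ = 1)
    (hlim : ∀ᵐ x ∂μ, Tendsto (fun n => g n x) atTop (𝓝 (f x))) :
    Tendsto (fun n => ∫⁻ x, ENNReal.ofReal |g n x - f x| ∂μ) atTop (𝓝 0) := by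
  have hgi : ∀ n, Integrable (g n) μ := fun n => integrable_of_integral_eq_one (hg1 n)
  have hfi : Integrable f μ := integrable_of_integral_eq_one hf1
  have hmi : ∀ n, Integrable (fun x => min (g n x) (f x)) μ := fun n => (hgi n).inf hfi
  have hmin : Tendsto (fun n => ∫ x, min (g n x) (f x) ∂μ) atTop (𝓝 1) := by
    rw [← hf1]
    refine tendsto_integral_of_dominated_convergence f (fun n => (hmi n).aestronglyMeasurable) hfi
      (fun n => Eventually.of_forall fun x => ?_) ?_
    · rw [Real.norm_of_nonneg (le_min (hg0 n x) (hf0 x))]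
      exact min_le_right _ _
    · filter_upwards [hlim] with x hx
      simpa using hx.min (tendsto_const_nhds (x := f x))
  have hval : ∀ n, ∫⁻ x, ENNReal.ofReal |g n x - f x| ∂μ =
      ENNReal.ofReal (2 - 2 * ∫ x, min (g n x) (f x) ∂μ) := by
    intro n
    have habs : Integrable (fun x => |g n x - f x|) μ := ((hgi n).sub hfi).abs
    rw [← ofReal_integral_eq_lintegral_ofReal habs
      (Eventually.of_forall fun x => abs_nonneg _)]
    congr 1
    calc ∫ x, |g n x - f x| ∂μ = ∫ x, (g n x + f x) - 2 * min (g n x) (f x) ∂μ := by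
          refine integral_congr_ae (Eventually.of_forall fun x => ?_)
          dsimp only
          rcases le_total (g n x) (f x) with h | h
          · rw [min_eq_left h, abs_of_nonpos (by linarith)]; ring
          · rw [min_eq_right h, abs_of_nonneg (by linarith)]; ring
      _ = 2 - 2 * ∫ x, min (g n x) (f x) ∂μ := by
          have hadd : Integrable (fun x => g n x + f x) μ := (hgi n).add hfi
          rw [integral_sub hadd ((hmi n).const_mul 2), integral_add (hgi n) hfi,
            integral_const_mul, hg1, hf1]
          norm_num
  simp only [hval]
  have := ENNReal.tendsto_ofReal ((hmin.const_mul 2).const_sub 2)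
  simpa using this

theorem integrable_exp_neg_norm {V : Type*} [NormedAddCommGroup V] [NormedSpace ℝ V]
    [FiniteDimensional ℝ V] [MeasurableSpace V] [BorelSpace V] (μ : Measure V)
    [μ.IsAddHaarMeasure] : Integrable (fun x : V => Real.exp (-‖x‖)) μ := by
  set m := Module.finrank ℝ V + 1 with hm
  have hr : (Module.finrank ℝ V : ℝ) < (m : ℝ) := by rw [hm]; push_cast; linarith
  refine ((integrable_one_add_norm (μ := μ) hr).const_mul (Real.exp 1 * m.factorial)).mono'
    (by fun_prop) (Eventually.of_forall fun x => ?_)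
  have hx : 0 < 1 + ‖x‖ := by positivity
  have h := Real.pow_div_factorial_le_exp (1 + ‖x‖) hx.le m
  rw [Real.norm_of_nonneg (Real.exp_pos _).le, Real.rpow_neg hx.le, Real.rpow_natCast,
    ← div_eq_mul_inv, le_div_iff₀ (by positivity), mul_comm]
  rw [div_le_iff₀ (by positivity), Real.exp_add] at h
  calc (1 + ‖x‖) ^ m * Real.exp (-‖x‖)
      ≤ (Real.exp 1 * Real.exp ‖x‖ * m.factorial) * Real.exp (-‖x‖) := by gcongr
    _ = Real.exp 1 * m.factorial * (Real.exp ‖x‖ * Real.exp (-‖x‖)) := by ring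
    _ = Real.exp 1 * m.factorial := by rw [← Real.exp_add]; simp

section Divergence

variable {d : ℕ} {f₀ : EuclideanSpace ℝ (Fin d) → ℝ}

theorem exists_isLogConcaveDensity_integrable_log (hf₀ : IsDensity f₀)
    (hmoment : Integrable fun x => ‖x‖ * f₀ x) :
    ∃ e : EuclideanSpace ℝ (Fin d) → ℝ, IsLogConcaveDensity e ∧ (∀ x, 0 < e x) ∧
      Integrable fun x => f₀ x * Real.log (e x) := by
  have hi := integrable_exp_neg_norm (volume : Measure (EuclideanSpace ℝ (Fin d)))
  set c := ∫ x : EuclideanSpace ℝ (Fin d), Real.exp (-‖x‖) with hc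
  have hcpos : 0 < c := integral_exp_pos hi
  refine ⟨fun x => Real.exp (-‖x‖) / c, ⟨by fun_prop, fun x => by positivity, ?_, ?_⟩,
    fun x => by positivity, ?_⟩
  · rw [integral_div, ← hc, div_self hcpos.ne']
  · intro x y s t hs ht hst
    have hc' : c ^ s * c ^ t = c := by rw [← Real.rpow_add hcpos, hst, Real.rpow_one]
    rw [Real.div_rpow (Real.exp_pos _).le hcpos.le, Real.div_rpow (Real.exp_pos _).le hcpos.le,
      div_mul_div_comm, hc', ← Real.exp_mul, ← Real.exp_mul, ← Real.exp_add]
    refine div_le_div_of_nonneg_right (Real.exp_le_exp.2 ?_) hcpos.le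
    have := norm_add_le (s • x) (t • y)
    rw [norm_smul, norm_smul, Real.norm_of_nonneg hs, Real.norm_of_nonneg ht] at this
    linarith
  · refine ((hmoment.neg).sub
      ((integrable_of_integral_eq_one hf₀.2.2).mul_const (Real.log c))).congr
      (Eventually.of_forall fun x => ?_)
    simp only [Pi.sub_apply, Pi.neg_apply]
    rw [Real.log_div (Real.exp_pos _).ne' hcpos.ne', Real.log_exp]
    ring

theorem integrable_mul_log_self (hf₀ : IsDensity f₀) (hmoment : Integrable fun x => ‖x‖ * f₀ x)
    (hlogplus : Integrable fun x => f₀ x * max (Real.log (f₀ x)) 0) :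
    Integrable fun x => f₀ x * Real.log (f₀ x) := by
  obtain ⟨e, he, hepos, hei⟩ := exists_isLogConcaveDensity_integrable_log hf₀ hmoment
  refine integrable_of_le_of_le
    (hf₀.1.mul (Real.measurable_log.comp hf₀.1)).aestronglyMeasurable
    (Eventually.of_forall fun x => mul_log_add_sub_le_mul_log (hf₀.2.1 x) (hepos x))
    (Eventually.of_forall fun x => mul_le_mul_of_nonneg_left (le_max_left _ _) (hf₀.2.1 x))
    ((hei.add (integrable_of_integral_eq_one hf₀.2.2)).sub
      (integrable_of_integral_eq_one he.2.2.1)) hlogplus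

theorem mul_log_div_ae_eq {g : EuclideanSpace ℝ (Fin d) → ℝ} (hg : ∀ᵐ x, g x = 0 → f₀ x = 0) :
    (fun x => f₀ x * Real.log (f₀ x / g x)) =ᵐ[volume]
      fun x => f₀ x * Real.log (f₀ x) - f₀ x * Real.log (g x) := by
  filter_upwards [hg] with x hx
  rcases eq_or_ne (f₀ x) 0 with h | h
  · simp [h]
  · rw [Real.log_div h fun h' => h (hx h'), mul_sub]

theorem klDiv_eq_ofReal_sub {g : EuclideanSpace ℝ (Fin d) → ℝ}
    (hself : Integrable fun x => f₀ x * Real.log (f₀ x))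
    (hg : Integrable fun x => f₀ x * Real.log (g x)) (hg0 : ∀ᵐ x, g x = 0 → f₀ x = 0) :
    klDiv f₀ g =
      ENNReal.ofReal ((∫ x, f₀ x * Real.log (f₀ x)) - ∫ x, f₀ x * Real.log (g x)) := by
  have h := mul_log_div_ae_eq hg0
  rw [klDiv, if_pos ⟨(hself.sub hg).congr h.symm, hg0⟩, integral_congr_ae h, integral_sub hself hg]

theorem integral_mul_log_le_integral_mul_log_self {g : EuclideanSpace ℝ (Fin d) → ℝ}
    (hf₀ : IsDensity f₀) (hself : Integrable fun x => f₀ x * Real.log (f₀ x))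
    (hg : IsDensity g) (hgi : Integrable fun x => f₀ x * Real.log (g x))
    (hg0 : ∀ᵐ x, g x = 0 → f₀ x = 0) :
    ∫ x, f₀ x * Real.log (g x) ≤ ∫ x, f₀ x * Real.log (f₀ x) := by
  have i1 := integrable_of_integral_eq_one hf₀.2.2
  have i2 := integrable_of_integral_eq_one hg.2.2
  have i3 : Integrable fun x => f₀ x * Real.log (g x) + f₀ x := hgi.add i1
  have h : ∫ x, f₀ x * Real.log (g x) + f₀ x - g x ≤ ∫ x, f₀ x * Real.log (f₀ x) := by
    refine integral_mono_ae (i3.sub i2) hself ?_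
    filter_upwards [hg0] with x hx
    rcases (hg.2.1 x).eq_or_lt with h | h
    · simp [hx h.symm, ← h]
    · exact mul_log_add_sub_le_mul_log (hf₀.2.1 x) h
  rw [integral_sub i3 i2, integral_add hgi i1, hf₀.2.2, hg.2.2] at h
  linarith

/-- A Kullback–Leibler minimiser has a finite divergence, hence an integrable log-likelihood. -/
theorem integrable_mul_log_of_isMin (hf₀ : IsDensity f₀)
    (hmoment : Integrable fun x => ‖x‖ * f₀ x)
    (hself : Integrable fun x => f₀ x * Real.log (f₀ x))
    {fstar : EuclideanSpace ℝ (Fin d) → ℝ}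
    (hmin : ∀ g, IsLogConcaveDensity g → klDiv f₀ fstar ≤ klDiv f₀ g) :
    (Integrable fun x => f₀ x * Real.log (fstar x)) ∧ ∀ᵐ x, fstar x = 0 → f₀ x = 0 := by
  obtain ⟨e, he, hepos, hei⟩ := exists_isLogConcaveDensity_integrable_log hf₀ hmoment
  have hfin : klDiv f₀ fstar ≠ ⊤ := by
    refine ((hmin e he).trans_lt ?_).ne
    rw [klDiv_eq_ofReal_sub hself hei (Eventually.of_forall fun x hx => absurd hx (hepos x).ne')]
    exact ENNReal.ofReal_lt_top
  rw [klDiv] at hfin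
  split_ifs at hfin with h
  · refine ⟨(hself.sub (h.1.congr (mul_log_div_ae_eq h.2))).congr
      (Eventually.of_forall fun x => ?_), h.2⟩
    simp
  · exact absurd rfl hfin

theorem integral_mul_log_le_of_isMin (hf₀ : IsDensity f₀)
    (hself : Integrable fun x => f₀ x * Real.log (f₀ x))
    {fstar g : EuclideanSpace ℝ (Fin d) → ℝ}
    (hmin : ∀ g, IsLogConcaveDensity g → klDiv f₀ fstar ≤ klDiv f₀ g)
    (hstar : Integrable fun x => f₀ x * Real.log (fstar x))
    (hstar0 : ∀ᵐ x, fstar x = 0 → f₀ x = 0) (hg : IsLogConcaveDensity g)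
    (hgi : Integrable fun x => f₀ x * Real.log (g x)) (hg0 : ∀ᵐ x, g x = 0 → f₀ x = 0) :
    ∫ x, f₀ x * Real.log (g x) ≤ ∫ x, f₀ x * Real.log (fstar x) := by
  have h := hmin g hg
  have h1 := integral_mul_log_le_integral_mul_log_self hf₀ hself ⟨hg.1, hg.2.1, hg.2.2.1⟩ hgi hg0
  rw [klDiv_eq_ofReal_sub hself hstar hstar0, klDiv_eq_ofReal_sub hself hgi hg0,
    ENNReal.ofReal_le_ofReal_iff (by linarith)] at h
  linarith

/-- Uniqueness of the Kullback–Leibler minimiser among log-concave functions of integral at most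
one, through the normalised geometric mean. -/
theorem ae_eq_of_integral_mul_log_le (hf₀ : IsDensity f₀)
    (hself : Integrable fun x => f₀ x * Real.log (f₀ x))
    {fstar F : EuclideanSpace ℝ (Fin d) → ℝ} (hfstar : IsLogConcaveDensity fstar)
    (hmin : ∀ g, IsLogConcaveDensity g → klDiv f₀ fstar ≤ klDiv f₀ g)
    (hstar : Integrable fun x => f₀ x * Real.log (fstar x))
    (hstar0 : ∀ᵐ x, fstar x = 0 → f₀ x = 0)
    (hF : IsLogConcave F) (hFm : Measurable F) (hFnn : ∀ x, 0 ≤ F x) (hFi : Integrable F)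
    (hF1 : ∫ x, F x ≤ 1) (hFlog : Integrable fun x => f₀ x * Real.log (F x))
    (hF0 : ∀ᵐ x, F x = 0 → f₀ x = 0)
    (hle : ∫ x, f₀ x * Real.log (fstar x) ≤ ∫ x, f₀ x * Real.log (F x)) :
    F =ᵐ[volume] fstar := by
  obtain ⟨hsm, hsnn, hs1, hslc⟩ := hfstar
  have hsi := integrable_of_integral_eq_one hs1
  have hf₀i := integrable_of_integral_eq_one hf₀.2.2
  set G : EuclideanSpace ℝ (Fin d) → ℝ := fun x => √(F x) * √(fstar x) with hG
  have hGnn : ∀ x, 0 ≤ G x := fun x => by positivity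
  have hsq : ∀ x, (√(F x) - √(fstar x)) ^ 2 = F x + fstar x - 2 * G x := fun x => by
    rw [sub_sq, Real.sq_sqrt (hFnn x), Real.sq_sqrt (hsnn x)]; simp only [hG]; ring
  have hGm : Measurable G := by fun_prop
  have hFsi : Integrable fun x => F x + fstar x := hFi.add hsi
  have hGi : Integrable G := hFsi.mono' hGm.aestronglyMeasurable
    (Eventually.of_forall fun x => by
      rw [Real.norm_of_nonneg (hGnn x)]
      nlinarith [hsq x, sq_nonneg (√(F x) - √(fstar x)), hGnn x])
  set Z := ∫ x, G x with hZ
  have hG0 : ∀ᵐ x, G x = 0 → f₀ x = 0 := by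
    filter_upwards [hF0, hstar0] with x h1 h2 h
    rcases mul_eq_zero.1 h with h | h
    · exact h1 ((Real.sqrt_eq_zero (hFnn x)).1 h)
    · exact h2 ((Real.sqrt_eq_zero (hsnn x)).1 h)
  have hZpos : 0 < Z := by
    refine lt_of_le_of_ne (integral_nonneg hGnn) fun h => ?_
    have h1 : G =ᵐ[volume] 0 := (integral_eq_zero_iff_of_nonneg hGnn hGi).1 h.symm
    have h2 : f₀ =ᵐ[volume] 0 := by
      filter_upwards [h1, hG0] with x hx hx' using hx' hx
    have := hf₀.2.2
    rw [integral_congr_ae h2] at this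
    simp at this
  have hlogeq : (fun x => f₀ x * Real.log (G x / Z)) =ᵐ[volume] fun x =>
      (1 / 2) * (f₀ x * Real.log (F x)) + (1 / 2) * (f₀ x * Real.log (fstar x)) -
        f₀ x * Real.log Z := by
    filter_upwards [hF0, hstar0] with x h1 h2
    rcases eq_or_ne (f₀ x) 0 with h | h
    · simp [h]
    · have p1 : 0 < F x := lt_of_le_of_ne (hFnn x) fun h' => h (h1 h'.symm)
      have p2 : 0 < fstar x := lt_of_le_of_ne (hsnn x) fun h' => h (h2 h'.symm)
      rw [Real.log_div (by positivity) hZpos.ne', Real.log_mul (by positivity) (by positivity),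
        Real.log_sqrt p1.le, Real.log_sqrt p2.le]
      ring
  have i1 : Integrable fun x =>
      (1 / 2) * (f₀ x * Real.log (F x)) + (1 / 2) * (f₀ x * Real.log (fstar x)) :=
    (hFlog.const_mul _).add (hstar.const_mul _)
  have hGlc : IsLogConcaveDensity fun x => G x / Z :=
    ⟨hGm.div_const Z, fun x => div_nonneg (hGnn x) hZpos.le,
      by rw [integral_div, ← hZ, div_self hZpos.ne'],
      hF.sqrt_mul_sqrt_div hslc hFnn hsnn hZpos⟩
  have hopt := integral_mul_log_le_of_isMin hf₀ hself hmin hstar hstar0 hGlc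
    ((i1.sub (hf₀i.mul_const (Real.log Z))).congr hlogeq.symm) (by
      filter_upwards [hG0] with x hx h
      exact hx ((div_eq_zero_iff.1 h).resolve_right hZpos.ne'))
  rw [integral_congr_ae hlogeq, integral_sub i1 (hf₀i.mul_const _),
    integral_add (hFlog.const_mul _) (hstar.const_mul _), integral_const_mul, integral_const_mul,
    integral_mul_const, hf₀.2.2, one_mul] at hopt
  have hZ1 : 1 ≤ Z := by
    by_contra h
    have := Real.log_neg hZpos (not_le.1 h)
    linarith
  have hH : ∫ x, (√(F x) - √(fstar x)) ^ 2 = 0 := by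
    refine le_antisymm ?_ (integral_nonneg fun x => sq_nonneg _)
    simp only [hsq]
    rw [integral_sub hFsi (hGi.const_mul 2), integral_add hFi hsi, integral_const_mul, hs1]
    linarith
  have hHi : Integrable fun x => (√(F x) - √(fstar x)) ^ 2 := by
    simp only [hsq]
    exact hFsi.sub (hGi.const_mul 2)
  have := (integral_eq_zero_iff_of_nonneg (fun x => sq_nonneg _) hHi).1 hH
  filter_upwards [this] with x hx
  have h1 : √(F x) = √(fstar x) := sub_eq_zero.1 (pow_eq_zero_iff (two_ne_zero) |>.1 hx)
  exact (Real.sqrt_inj (hFnn x) (hsnn x)).1 h1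

end Divergence

/-- A log-likelihood bound along a convergent sequence of uniformly bounded functions passes to the
limit. -/
theorem le_integral_log_of_tendsto {α : Type*} [MeasurableSpace α] {μ : Measure α} {f₀ F : α → ℝ}
    {g : ℕ → α → ℝ} (hf₀ : Integrable f₀ μ) (hf₀0 : ∀ x, 0 ≤ f₀ x) (hgm : ∀ k, Measurable (g k))
    (hg0 : ∀ k x, 0 ≤ g k x) {M : ℝ} (hM : ∀ k x, g k x ≤ M) (hF0 : ∀ x, 0 ≤ F x)
    (hlim : ∀ᵐ x ∂μ, Tendsto (fun k => g k x) atTop (𝓝 (F x))) {b L : ℝ} (hb : 0 < b)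
    (hL : ∀ᶠ k in atTop, L ≤ ∫ x, f₀ x * Real.log (b + g k x) ∂μ) :
    L ≤ ∫ x, f₀ x * Real.log (b + F x) ∂μ := by
  refine ge_of_tendsto (tendsto_integral_of_dominated_convergence
    (fun x => f₀ x * (|Real.log b| + |Real.log (b + M)|)) (fun k => ?_) (hf₀.mul_const _)
    (fun k => Eventually.of_forall fun x => ?_) ?_) hL
  · exact hf₀.aestronglyMeasurable.mul
      (Real.measurable_log.comp ((hgm k).const_add b)).aestronglyMeasurable
  · rw [norm_mul, Real.norm_of_nonneg (hf₀0 x), Real.norm_eq_abs]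
    refine mul_le_mul_of_nonneg_left ?_ (hf₀0 x)
    have h0 := hg0 k x
    have h1 := Real.log_le_log hb (show b ≤ b + g k x by linarith)
    have h2 := Real.log_le_log (show 0 < b + g k x by linarith)
      (show b + g k x ≤ b + M by linarith [hM k x])
    rw [abs_le]
    constructor
    · linarith [neg_abs_le (Real.log b), abs_nonneg (Real.log (b + M))]
    · linarith [le_abs_self (Real.log (b + M)), abs_nonneg (Real.log b)]
  · filter_upwards [hlim] with x hx
    have hne : b + F x ≠ 0 := by linarith [hF0 x]
    exact ((Real.continuousAt_log hne).tendsto.comp (hx.const_add b)).const_mul _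

theorem integrable_and_integral_le_one_of_tendsto_ae {α : Type*} [MeasurableSpace α]
    {μ : Measure α} {F : α → ℝ} {g : ℕ → α → ℝ} (hFm : Measurable F) (hF0 : ∀ x, 0 ≤ F x)
    (hg0 : ∀ k x, 0 ≤ g k x) (hg1 : ∀ k, ∫ x, g k x ∂μ = 1)
    (hlim : ∀ᵐ x ∂μ, Tendsto (fun k => g k x) atTop (𝓝 (F x))) :
    Integrable F μ ∧ ∫ x, F x ∂μ ≤ 1 := by
  have hgi : ∀ k, Integrable (g k) μ := fun k => integrable_of_integral_eq_one (hg1 k)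
  have hle : ∫⁻ x, ENNReal.ofReal (F x) ∂μ ≤ 1 := by
    calc ∫⁻ x, ENNReal.ofReal (F x) ∂μ
        = ∫⁻ x, liminf (fun k => ENNReal.ofReal (g k x)) atTop ∂μ := by
          refine lintegral_congr_ae ?_
          filter_upwards [hlim] with x hx using (ENNReal.tendsto_ofReal hx).liminf_eq.symm
      _ ≤ liminf (fun k => ∫⁻ x, ENNReal.ofReal (g k x) ∂μ) atTop :=
          lintegral_liminf_le' fun k => (hgi k).aemeasurable.ennreal_ofReal
      _ = 1 := by
          have h : ∀ k, ∫⁻ x, ENNReal.ofReal (g k x) ∂μ = 1 := fun k => by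
            rw [← ofReal_integral_eq_lintegral_ofReal (hgi k) (Eventually.of_forall (hg0 k)), hg1,
              ENNReal.ofReal_one]
          simp only [h]
          exact tendsto_const_nhds.liminf_eq
  have hFi : Integrable F μ := ⟨hFm.aestronglyMeasurable,
    (hasFiniteIntegral_iff_ofReal (Eventually.of_forall hF0)).2 (hle.trans_lt ENNReal.one_lt_top)⟩
  refine ⟨hFi, ?_⟩
  rwa [← ofReal_integral_eq_lintegral_ofReal hFi (Eventually.of_forall hF0),
    ENNReal.ofReal_le_one] at hle

/-- The measure with density `f₀` charges every ball centred in the support of `f₀`. -/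
theorem IsDensity.withDensity_ball_pos {d : ℕ} {f₀ : EuclideanSpace ℝ (Fin d) → ℝ}
    (hf₀ : IsDensity f₀) {E : Set (EuclideanSpace ℝ (Fin d))}
    (hEmin : ∀ F, IsClosed F → (∫ x in F, f₀ x = 1) → E ⊆ F) {z : EuclideanSpace ℝ (Fin d)}
    (hz : z ∈ E) {ρ : ℝ} (hρ : 0 < ρ) :
    0 < volume.withDensity (fun x => ENNReal.ofReal (f₀ x)) (Metric.ball z ρ) := by
  have hi := integrable_of_integral_eq_one hf₀.2.2
  rw [pos_iff_ne_zero]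
  intro h
  rw [withDensity_apply _ measurableSet_ball, ← ofReal_integral_eq_lintegral_ofReal
    hi.integrableOn (Eventually.of_forall hf₀.2.1), ENNReal.ofReal_eq_zero] at h
  have h0 : ∫ x in Metric.ball z ρ, f₀ x = 0 :=
    le_antisymm h (integral_nonneg hf₀.2.1)
  have h1 := integral_add_compl (measurableSet_ball (x := z) (ε := ρ)) hi
  rw [h0, zero_add, hf₀.2.2] at h1
  exact hEmin _ Metric.isOpen_ball.isClosed_compl h1 hz (Metric.mem_ball_self hρ)

/-- The iterated `limsup` condition gives a lower bound for the regularised log-likelihoods. -/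
theorem eventually_le_integral_log_of_limsup_le {d : ℕ} {f₀ : EuclideanSpace ℝ (Fin d) → ℝ}
    (hf₀ : IsDensity f₀) (hlogplus : Integrable fun x => f₀ x * max (Real.log (f₀ x)) 0)
    {fstar : EuclideanSpace ℝ (Fin d) → ℝ} (hfstar : IsDensity fstar)
    (hstar : Integrable fun x => f₀ x * Real.log (fstar x))
    (hstar0 : ∀ᵐ x, fstar x = 0 → f₀ x = 0)
    {fs : ℕ → EuclideanSpace ℝ (Fin d) → ℝ} (hfs : ∀ n, IsDensity (fs n))
    (hlimsup :
      Filter.limsup (fun b : ℝ =>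
        Filter.limsup (fun n : ℕ =>
          ((∫ x, Real.log ((b + fstar x) / (b + fs n x)) * f₀ x : ℝ) : EReal)) atTop)
        (𝓝[>] (0 : ℝ)) ≤ (0 : EReal)) {ε : ℝ} (hε : 0 < ε) :
    ∀ᶠ b in 𝓝[>] (0 : ℝ), ∀ᶠ n in atTop,
      (∫ x, f₀ x * Real.log (fstar x)) - ε ≤ ∫ x, f₀ x * Real.log (b + fs n x) := by
  have hf₀i := integrable_of_integral_eq_one hf₀.2.2
  have h1 := eventually_lt_of_limsup_lt (hlimsup.trans_lt (EReal.coe_pos.2 hε))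
  filter_upwards [h1, self_mem_nhdsWithin] with b hb hb0
  have hb0 : 0 < b := hb0
  filter_upwards [eventually_lt_of_limsup_lt hb] with n hn
  have hn := EReal.coe_lt_coe_iff.1 hn
  have i1 := integrable_mul_log_const_add hf₀i hf₀.2.1 hlogplus
    (integrable_of_integral_eq_one hfstar.2.2) hfstar.2.1 hb0
  have i2 := integrable_mul_log_const_add hf₀i hf₀.2.1 hlogplus
    (integrable_of_integral_eq_one (hfs n).2.2) (hfs n).2.1 hb0
  have h2 : ∫ x, Real.log ((b + fstar x) / (b + fs n x)) * f₀ x =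
      (∫ x, f₀ x * Real.log (b + fstar x)) - ∫ x, f₀ x * Real.log (b + fs n x) := by
    rw [← integral_sub i1 i2]
    refine integral_congr_ae (Eventually.of_forall fun x => ?_)
    have p1 := hfstar.2.1 x
    have p2 := (hfs n).2.1 x
    dsimp only
    rw [Real.log_div (by positivity) (by positivity)]
    ring
  have h3 : ∫ x, f₀ x * Real.log (fstar x) ≤ ∫ x, f₀ x * Real.log (b + fstar x) := by
    refine integral_mono_ae hstar i1 ?_
    filter_upwards [hstar0] with x hx
    rcases (hfstar.2.1 x).eq_or_lt with h | h
    · simp [hx h.symm]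
    · exact mul_le_mul_of_nonneg_left (Real.log_le_log h (by linarith)) (hf₀.2.1 x)
  linarith

/-- A lower bound for the regularised log-likelihoods of log-concave densities forces them to be
bounded below on a common ball and uniformly bounded above. -/
theorem exists_eventually_le_on_ball_and_le {d : ℕ} {f₀ : EuclideanSpace ℝ (Fin d) → ℝ}
    (hf₀ : IsDensity f₀) (hlogplus : Integrable fun x => f₀ x * max (Real.log (f₀ x)) 0)
    {E : Set (EuclideanSpace ℝ (Fin d))}
    (hEmin : ∀ F, IsClosed F → (∫ x in F, f₀ x = 1) → E ⊆ F)
    (hEinterior : (interior E).Nonempty) {fs : ℕ → EuclideanSpace ℝ (Fin d) → ℝ}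
    (hfs : ∀ n, IsLogConcaveDensity (fs n)) {L : ℝ}
    (hL : ∃ᶠ b in 𝓝[>] (0 : ℝ), ∀ᶠ n in atTop, L ≤ ∫ x, f₀ x * Real.log (b + fs n x)) :
    ∃ x₀, ∃ r > 0, ∃ c > 0, ∃ M : ℝ, ∀ᶠ n in atTop,
      (∀ y ∈ Metric.ball x₀ r, c ≤ fs n y) ∧ ∀ x, fs n x ≤ M := by
  have hf₀i := integrable_of_integral_eq_one hf₀.2.2
  obtain ⟨x₀, r, hr, p, hp, hball⟩ := exists_ball_subset_of_measure_compl_lt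
    (volume.withDensity fun x => ENNReal.ofReal (f₀ x)) isOpen_interior hEinterior
    fun z hz ρ hρ => hf₀.withDensity_ball_pos hEmin (interior_subset hz) hρ
  obtain ⟨p', hp', hpp⟩ := ENNReal.lt_iff_exists_real_btwn.1 hp
  have hp'0 : 0 < p' := by simpa using hpp.1
  obtain ⟨b₀, hb₀, hmass⟩ :=
    exists_setIntegral_lt_of_le_integral_log hf₀i hf₀.2.1 hf₀.2.2 hlogplus L hp'0
  obtain ⟨b, hb, hbL, hbb⟩ := (hL.and_eventually (Ioo_mem_nhdsGT hb₀)).exists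
  refine ⟨x₀, r, hr, b, hbL, 1 / (b * volume.real (Metric.ball (0 : EuclideanSpace ℝ (Fin d))
    (r / 2)) ^ 2), ?_⟩
  filter_upwards [hb] with n hn
  obtain ⟨hm, h0, h1, hlc⟩ := hfs n
  have hi := integrable_of_integral_eq_one h1
  have hlc' : IsLogConcave (fs n) := hlc
  have hB : ∀ y ∈ Metric.ball x₀ r, b ≤ fs n y := by
    have hcompl : {x | b ≤ fs n x}ᶜ = {x | fs n x < b} := by ext; simp
    refine hball {x | b ≤ fs n x} (hlc'.convex_le h0 b) (hpp.2.trans_le' ?_)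
    rw [hcompl, withDensity_apply _ (measurableSet_lt hm measurable_const),
      ← ofReal_integral_eq_lintegral_ofReal hf₀i.integrableOn (Eventually.of_forall hf₀.2.1)]
    exact ENNReal.ofReal_le_ofReal (hmass b hbL hbb _ hm hi h0 h1.le hn).le
  exact ⟨hB, hlc'.le_of_le_on_ball volume h0 hi h1.le hr hbL hB⟩

/-- If a sequence of log-concave densities `fₙ` satisfies
`limsup_{b ↓ 0} limsup_{n → ∞} ∫ log((b + f*)/(b + fₙ)) f₀ ≤ 0`, where `f*` is the
log-concave density minimising the Kullback–Leibler divergence from `f₀`, then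
`fₙ → f*` in total variation (the limsups are taken in the extended reals). -/
theorem tendsto_L1_of_limsup_log_ratio {d : ℕ}
    (f₀ : EuclideanSpace ℝ (Fin d) → ℝ) (hf₀ : IsDensity f₀)
    (hmoment : Integrable (fun x => ‖x‖ * f₀ x))
    (hlogplus : Integrable (fun x => f₀ x * max (Real.log (f₀ x)) 0))
    (E : Set (EuclideanSpace ℝ (Fin d))) (hEclosed : IsClosed E)
    (hEint : ∫ x in E, f₀ x = 1)
    (hEmin : ∀ F, IsClosed F → (∫ x in F, f₀ x = 1) → E ⊆ F)
    (hEinterior : (interior E).Nonempty)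
    (fstar : EuclideanSpace ℝ (Fin d) → ℝ) (hfstar : IsLogConcaveDensity fstar)
    (hmin : ∀ g, IsLogConcaveDensity g → klDiv f₀ fstar ≤ klDiv f₀ g)
    (fs : ℕ → EuclideanSpace ℝ (Fin d) → ℝ) (hfs : ∀ n, IsLogConcaveDensity (fs n))
    (hlimsup :
      Filter.limsup (fun b : ℝ =>
        Filter.limsup (fun n : ℕ =>
          ((∫ x, Real.log ((b + fstar x) / (b + fs n x)) * f₀ x : ℝ) : EReal)) atTop)
        (𝓝[>] (0 : ℝ)) ≤ (0 : EReal)) :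
    Tendsto (fun n => ∫⁻ x, ENNReal.ofReal |fs n x - fstar x|) atTop (nhds 0) := by
  have hself := integrable_mul_log_self hf₀ hmoment hlogplus
  obtain ⟨hstar, hstar0⟩ := integrable_mul_log_of_isMin hf₀ hmoment hself hmin
  have hf₀i := integrable_of_integral_eq_one hf₀.2.2
  have hlower : ∀ ε > 0, ∀ᶠ b in 𝓝[>] (0 : ℝ), ∀ᶠ n in atTop,
      (∫ x, f₀ x * Real.log (fstar x)) - ε ≤ ∫ x, f₀ x * Real.log (b + fs n x) := fun ε hε =>
    eventually_le_integral_log_of_limsup_le hf₀ hlogplus ⟨hfstar.1, hfstar.2.1, hfstar.2.2.1⟩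
      hstar hstar0 (fun n => ⟨(hfs n).1, (hfs n).2.1, (hfs n).2.2.1⟩) hlimsup hε
  obtain ⟨x₀, r, hr, c, hc, M, hbounds⟩ := exists_eventually_le_on_ball_and_le hf₀ hlogplus hEmin
    hEinterior hfs (hlower 1 one_pos).frequently
  refine tendsto_of_subseq_tendsto fun ns hns => ?_
  obtain ⟨K, hK⟩ := eventually_atTop.1 (hns.eventually hbounds)
  have hK' : ∀ k, (∀ y ∈ Metric.ball x₀ r, c ≤ fs (ns (k + K)) y) ∧ ∀ x, fs (ns (k + K)) x ≤ M :=
    fun k => hK (k + K) (Nat.le_add_left K k)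
  obtain ⟨φ, hφ, hlim⟩ := exists_subseq_tendsto_liminf_ae volume
    (fs := fun k => fs (ns (k + K))) (fun k => (hfs _).2.2.2) (fun k => (hfs _).2.1)
    (fun k => (hK' k).2) hr hc fun k => (hK' k).1
  refine ⟨fun k => φ k + K, ?_⟩
  have hsub : Tendsto (fun k => ns (φ k + K)) atTop atTop :=
    hns.comp ((tendsto_add_atTop_nat K).comp hφ.tendsto_atTop)
  set g : ℕ → EuclideanSpace ℝ (Fin d) → ℝ := fun k => fs (ns (φ k + K)) with hg
  set F : EuclideanSpace ℝ (Fin d) → ℝ := fun x => liminf (fun k => g k x) atTop with hF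
  have hgd : ∀ k, IsLogConcaveDensity (g k) := fun k => hfs _
  have hgM : ∀ k x, g k x ≤ M := fun k => (hK' (φ k)).2
  have hFlc : IsLogConcave F := IsLogConcave.liminf (fun k => (hgd k).2.2.2)
    (fun k => (hgd k).2.1) hgM
  have hFm : Measurable F := Measurable.liminf fun k => (hgd k).1
  have hF0 : ∀ x, 0 ≤ F x := fun x => le_liminf_of_le
    (isBoundedUnder_of ⟨M, fun k => hgM k x⟩).isCoboundedUnder_ge
    (Eventually.of_forall fun k => (hgd k).2.1 x)
  obtain ⟨hFi, hF1⟩ := integrable_and_integral_le_one_of_tendsto_ae hFm hF0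
    (fun k => (hgd k).2.1) (fun k => (hgd k).2.2.1) hlim
  obtain ⟨hFz, hFlog, hle⟩ := le_integral_log_of_frequently hf₀.1 hFm hf₀i hf₀.2.1 hlogplus hFi hF0
    (L := ∫ x, f₀ x * Real.log (fstar x)) fun ε hε => by
      refine ((hlower ε hε).and self_mem_nhdsWithin).frequently.mono fun b hb => ?_
      exact le_integral_log_of_tendsto hf₀i hf₀.2.1 (fun k => (hgd k).1) (fun k => (hgd k).2.1) hgM
        hF0 hlim hb.2 (hsub.eventually hb.1)
  have heq := ae_eq_of_integral_mul_log_le hf₀ hself hfstar hmin hstar hstar0 hFlc hFm hF0 hFi hF1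
    hFlog hFz hle
  refine tendsto_lintegral_abs_sub_of_tendsto_ae (fun k => (hgd k).2.1) hfstar.2.1
    (fun k => (hgd k).2.2.1) hfstar.2.2.1 ?_
  filter_upwards [hlim, heq] with x hx hxF
  rwa [← hxF]
end

section
/- Let Φ(x) = (1 + x) log(1 + x) − x for x ≥ 0, let f₀ : ℝ^d → [0,∞) be measurable, and suppose there exists λ > 0 with ∫_{ℝ^d} Φ(f₀(x)/λ) dx ≤ 1. Then for every Borel set D ⊆ ℝ^d with 0 < μ(D) < 1, one has ∫_D f₀ dμ ≤ 2λ / log(1/μ(D)). -/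
open MeasureTheory

/-- Young's inequality for `Φ(x) = (1 + x) log (1 + x) − x`, with the conjugate function
`exp y − 1 − y` bounded by `exp y`. -/
theorem mul_le_orlicz_add_exp {x y : ℝ} (hx : 0 ≤ x) (hy : 0 ≤ y) :
    x * y ≤ ((1 + x) * Real.log (1 + x) - x) + Real.exp y := by
  have ht : 0 < 1 + x := by linarith
  have h := mul_le_mul_of_nonneg_left (Real.add_one_le_exp (y - Real.log (1 + x))) ht.le
  rw [Real.exp_sub, Real.exp_log ht, mul_div_cancel₀ _ ht.ne'] at h
  linarith

/-- An Orlicz-norm bound: if `∫ Φ(f₀/λ) ≤ 1` for the Young function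
`Φ(x) = (1 + x) log (1 + x) − x`, then for every Borel set `D` with
`0 < μ(D) < 1` we have `∫_D f₀ ≤ 2λ / log (1/μ(D))`. -/
theorem integral_le_of_orlicz_bound {d : ℕ}
    (f₀ : EuclideanSpace ℝ (Fin d) → ℝ) (hmeas : Measurable f₀) (hnn : ∀ x, 0 ≤ f₀ x)
    (lam : ℝ) (hlam : 0 < lam)
    (hOrlicz : ∫⁻ x, ENNReal.ofReal
        ((1 + f₀ x / lam) * Real.log (1 + f₀ x / lam) - f₀ x / lam) ≤ 1)
    (D : Set (EuclideanSpace ℝ (Fin d))) (hD : MeasurableSet D)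
    (hDpos : 0 < volume D) (hDlt : volume D < 1) :
    ∫⁻ x in D, ENNReal.ofReal (f₀ x) ≤
      ENNReal.ofReal (2 * lam / Real.log (1 / (volume D).toReal)) := by
  set m := (volume D).toReal with hm
  have hm0 : 0 < m := ENNReal.toReal_pos hDpos.ne' hDlt.ne_top
  have hm1 : m < 1 := by
    simpa using (ENNReal.toReal_lt_toReal hDlt.ne_top ENNReal.one_ne_top).2 hDlt
  set L := Real.log (1 / m) with hL
  have hL0 : 0 < L := Real.log_pos ((one_lt_div hm0).2 hm1)
  have hexp : Real.exp L = 1 / m := Real.exp_log (by positivity)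
  have hpt : ∀ x, ENNReal.ofReal (f₀ x) ≤ ENNReal.ofReal (lam / L) *
      (ENNReal.ofReal ((1 + f₀ x / lam) * Real.log (1 + f₀ x / lam) - f₀ x / lam) +
        ENNReal.ofReal (1 / m)) := by
    intro x
    have hy := mul_le_orlicz_add_exp (div_nonneg (hnn x) hlam.le) hL0.le
    rw [hexp] at hy
    calc ENNReal.ofReal (f₀ x) = ENNReal.ofReal (lam / L * (f₀ x / lam * L)) := by
          congr 1; field_simp
      _ ≤ _ := by
          rw [ENNReal.ofReal_mul (by positivity)]
          gcongr
          exact (ENNReal.ofReal_le_ofReal hy).trans ENNReal.ofReal_add_le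
  have hconst : ENNReal.ofReal (1 / m) * volume D = 1 := by
    rw [← ENNReal.ofReal_toReal hDlt.ne_top, ← hm, ← ENNReal.ofReal_mul (by positivity),
      one_div_mul_cancel hm0.ne', ENNReal.ofReal_one]
  calc ∫⁻ x in D, ENNReal.ofReal (f₀ x)
      ≤ ∫⁻ x in D, ENNReal.ofReal (lam / L) *
        (ENNReal.ofReal ((1 + f₀ x / lam) * Real.log (1 + f₀ x / lam) - f₀ x / lam) +
          ENNReal.ofReal (1 / m)) := lintegral_mono hpt
    _ = ENNReal.ofReal (lam / L) *
        ((∫⁻ x in D, ENNReal.ofReal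
          ((1 + f₀ x / lam) * Real.log (1 + f₀ x / lam) - f₀ x / lam)) + 1) := by
        rw [lintegral_const_mul' _ _ ENNReal.ofReal_ne_top,
          lintegral_add_right _ measurable_const, setLIntegral_const, hconst]
    _ ≤ ENNReal.ofReal (lam / L) * (1 + 1) := by
        gcongr
        exact (setLIntegral_le_lintegral _ _).trans hOrlicz
    _ = ENNReal.ofReal (2 * lam / L) := by
        rw [one_add_one_eq_two, ← ENNReal.ofReal_ofNat 2, ← ENNReal.ofReal_mul (by positivity)]
        congr 1; ring
end

section
/- Let f be a log-concave density on ℝ^d with f(x) ≤ C for all x ∈ ℝ^d (for some C > 0), let b > 0, and let ν and P be Borel probability measures on ℝ^d. Then ∫_{ℝ^d} log(1 + f(x)/b) dν(x) − ∫_{ℝ^d} log(1 + f(x)/b) dP(x) ≤ log(1 + C/b) · sup_{D ∈ 𝒟} (ν(D) − P(D)), where 𝒟 denotes the class of all Borel-measurable convex subsets of ℝ^d. -/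
open MeasureTheory

lemma integrableOn_measureReal_superlevel {α : Type*} [MeasurableSpace α]
    (μ : Measure α) [IsFiniteMeasure μ] (g : α → ℝ) (a b : ℝ) :
    IntegrableOn (fun t => μ.real {x | t ≤ g x}) (Set.Ioc a b) := by
  have h : Antitone fun t : ℝ => μ.real {x | t ≤ g x} := fun s t hst =>
    measureReal_mono fun _ hx => hst.trans hx
  exact ((h.antitoneOn _).integrableOn_isCompact isCompact_Icc).mono_set Set.Ioc_subset_Icc_self

/-- Integrals of a bounded nonnegative function against two probability measures differ by at most
its upper bound times any uniform bound on the discrepancy over its superlevel sets. -/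
lemma integral_sub_integral_le_of_superlevel {α : Type*} [MeasurableSpace α]
    (μ ν : Measure α) [IsFiniteMeasure μ] [IsFiniteMeasure ν] {g : α → ℝ}
    (hg : Measurable g) {M S : ℝ} (hM : 0 ≤ M) (hg0 : ∀ x, 0 ≤ g x) (hgM : ∀ x, g x ≤ M)
    (hS : ∀ t, 0 < t → μ.real {x | t ≤ g x} - ν.real {x | t ≤ g x} ≤ S) :
    ∫ x, g x ∂μ - ∫ x, g x ∂ν ≤ M * S := by
  have key : ∀ (ρ : Measure α) [IsFiniteMeasure ρ],
      ∫ x, g x ∂ρ = ∫ t in Set.Ioc 0 M, ρ.real {x | t ≤ g x} := by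
    intro ρ _
    have hint : Integrable g ρ := Integrable.of_bound hg.aestronglyMeasurable M
      (.of_forall fun x => by rw [Real.norm_of_nonneg (hg0 x)]; exact hgM x)
    exact hint.integral_eq_integral_Ioc_meas_le (.of_forall hg0) (.of_forall hgM)
  have hμ := integrableOn_measureReal_superlevel μ g 0 M
  have hν := integrableOn_measureReal_superlevel ν g 0 M
  rw [key μ, key ν, ← integral_sub hμ hν]
  calc ∫ t in Set.Ioc 0 M, (μ.real {x | t ≤ g x} - ν.real {x | t ≤ g x})
      ≤ ∫ _ in Set.Ioc 0 M, S :=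
        setIntegral_mono_on (hμ.sub hν) (integrableOn_const (by simp)) measurableSet_Ioc
          fun t ht => hS t ht.1
    _ = M * S := by simp [hM]

lemma IsLogConcaveDensity.convex_superlevel {d : ℕ} {f : EuclideanSpace ℝ (Fin d) → ℝ}
    (hf : IsLogConcaveDensity f) {r : ℝ} (hr : 0 < r) : Convex ℝ {x | r ≤ f x} := by
  intro x hx y hy s t hs ht hst
  refine le_trans ?_ (hf.2.2.2 x y s t hs ht hst)
  calc r = r ^ s * r ^ t := by rw [← Real.rpow_add hr, hst, Real.rpow_one]
    _ ≤ f x ^ s * f y ^ t := mul_le_mul (Real.rpow_le_rpow hr.le hx hs)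
        (Real.rpow_le_rpow hr.le hy ht) (by positivity) (Real.rpow_nonneg (hf.2.1 x) s)

/-- For a log-concave density `f` bounded by `C`, any `b > 0` and Borel probability
measures `ν, P` on ℝ^d, the difference of the integrals of `log (1 + f/b)` is
controlled by `log (1 + C/b)` times the supremum of `ν(D) − P(D)` over all
Borel-measurable convex sets `D`. -/
theorem integral_log_diff_le_sup_convex {d : ℕ}
    (f : EuclideanSpace ℝ (Fin d) → ℝ) (hf : IsLogConcaveDensity f)
    (C : ℝ) (hC : 0 < C) (hfC : ∀ x, f x ≤ C) (b : ℝ) (hb : 0 < b)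
    (ν P : Measure (EuclideanSpace ℝ (Fin d)))
    [IsProbabilityMeasure ν] [IsProbabilityMeasure P] :
    (∫ x, Real.log (1 + f x / b) ∂ν) - ∫ x, Real.log (1 + f x / b) ∂P ≤
      Real.log (1 + C / b) *
        ⨆ D : {D : Set (EuclideanSpace ℝ (Fin d)) // Convex ℝ D ∧ MeasurableSet D},
          ((ν D.1).toReal - (P D.1).toReal) := by
  have hpos : ∀ x, 0 < 1 + f x / b := fun x => by
    have := div_nonneg (hf.2.1 x) hb.le
    linarith
  have hCb : 0 < C / b := div_pos hC hb
  have hmeas : Measurable fun x => Real.log (1 + f x / b) :=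
    Real.measurable_log.comp ((hf.1.div_const b).const_add 1)
  refine integral_sub_integral_le_of_superlevel ν P hmeas (Real.log_nonneg (by linarith))
    (fun x => Real.log_nonneg (by linarith [div_nonneg (hf.2.1 x) hb.le]))
    (fun x => Real.log_le_log (hpos x) (by gcongr; exact hfC x)) fun t ht => ?_
  have hset : {x | t ≤ Real.log (1 + f x / b)} = {x | (Real.exp t - 1) * b ≤ f x} := by
    ext x
    rw [Set.mem_ofPred_eq, Set.mem_ofPred_eq, Real.le_log_iff_exp_le (hpos x), ← le_div_iff₀ hb,
      sub_le_iff_le_add']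
  have hconv : Convex ℝ {x | t ≤ Real.log (1 + f x / b)} := by
    rw [hset]
    exact hf.convex_superlevel (mul_pos (by linarith [Real.add_one_lt_exp ht.ne']) hb)
  refine le_ciSup (f := fun D : {D : Set (EuclideanSpace ℝ (Fin d)) //
    Convex ℝ D ∧ MeasurableSet D} => (ν D.1).toReal - (P D.1).toReal) ⟨1, ?_⟩
    ⟨_, hconv, measurableSet_le measurable_const hmeas⟩
  rintro _ ⟨D, rfl⟩
  exact (sub_le_self _ ENNReal.toReal_nonneg).trans measureReal_le_one
end
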